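/- Let α, β ∈ (0,1). For ν ≥ 0 define S₁(ν) = (1/2)·erfc(ν/√2) + (ν/√(2π))·e^{−ν²/2}, S₂ = β + (1/√π)·erfinv(2(1−β)−1)·e^{−(erfinv(2(1−β)−1))²}, and S₃(ν) = ( (1/2)·erfc(ν/√2) + β )·ν² + ν·√(2/π)·( e^{−(erfinv(2(1−β)−1))²} − e^{−ν²/2} ). Assume α > min_{ν ≥ 0} ( S₁(ν) + S₂ + S₃(ν) ). Then there exists ε > 0 such that for all sufficiently large n, with m = ⌈αn⌉, k = ⌈βn⌉, and A an m×n random matrix with i.i.d. standard normal entries, the probability is at least 1 − e^{−εn} that every x ∈ ℝ^n with x_i ≥ 0 for all i and at most k nonzero entries is the unique solution of the optimization problem: minimize ‖z‖₁ subject to Az = Ax and z_i ≥ 0 for all i. -/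

import Mathlib

open MeasureTheory ProbabilityTheory

/-- The standard error function `erf x = (2/√π) ∫₀ˣ e^{−t²} dt`. -/
noncomputable def erf (x : ℝ) : ℝ :=
  (2 / Real.sqrt Real.pi) * ∫ t in (0 : ℝ)..x, Real.exp (-t ^ 2)

/-- The complementary error function. -/
noncomputable def erfc (x : ℝ) : ℝ := 1 - erf x

/-- The inverse of the error function (on `(−1,1)`). -/
noncomputable def erfinv (y : ℝ) : ℝ := Function.invFun erf y

/-- `x` is the unique minimizer of `‖z‖₁` subject to `Az = Ax` and `z ≥ 0`. -/
def UniqueL1MinNonneg {m n : ℕ} (A : Fin m → Fin n → ℝ) (x : Fin n → ℝ) : Prop :=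
  ∀ z : Fin n → ℝ, (∀ i, ∑ j, A i j * z j = ∑ j, A i j * x j) → (∀ i, 0 ≤ z i) →
    z ≠ x → ∑ i, |x i| < ∑ i, |z i|

/-- The law of an `m × n` matrix with i.i.d. standard normal entries. -/
noncomputable def matrixGaussian (m n : ℕ) : Measure (Fin m → Fin n → ℝ) :=
  Measure.pi fun _ => Measure.pi fun _ => gaussianReal 0 1

set_option linter.unusedVariables false
set_option linter.unusedSectionVars false


lemma pi_gauss_density {ι : Type*} [Fintype ι] :
    (Measure.pi fun _ : ι => gaussianReal 0 1) =
      (volume : Measure (ι → ℝ)).withDensity (fun x => ENNReal.ofReal (∏ i, gaussianPDFReal 0 1 (x i))) := by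
  apply Measure.pi_eq
  intro s hs
  rw [withDensity_apply _ (MeasurableSet.univ_pi hs), ← ofReal_integral_eq_lintegral_ofReal]
  · rw [volume_pi, Measure.restrict_pi_pi, integral_fintype_prod_eq_prod (fun _ => gaussianPDFReal 0 1),
      ENNReal.ofReal_prod_of_nonneg]
    · refine Finset.prod_congr rfl fun i _ => ?_
      rw [gaussianReal_apply_eq_integral _ one_ne_zero]
    · intro i _
      exact integral_nonneg fun x => gaussianPDFReal_nonneg _ _ _
  · apply Integrable.integrableOn
    exact Integrable.fintype_prod (f := fun (_ : ι) x => gaussianPDFReal 0 1 x) fun i => integrable_gaussianPDFReal 0 1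
  · exact ae_of_all _ fun x => Finset.prod_nonneg fun i _ => gaussianPDFReal_nonneg _ _ _

lemma meas_dens {ι : Type*} [Fintype ι] :
    Measurable (fun x : ι → ℝ => (∏ i, gaussianPDFReal 0 1 (x i))) := by
  refine Finset.measurable_prod _ fun i _ => ?_
  exact (measurable_gaussianPDFReal 0 1).comp (measurable_pi_apply i)

lemma integral_pi_gauss {ι : Type*} [Fintype ι] (f : (ι → ℝ) → ℝ) :
    ∫ x, f x ∂(Measure.pi fun _ : ι => gaussianReal 0 1) =
      ∫ x, (∏ i, gaussianPDFReal 0 1 (x i)) * f x := by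
  rw [pi_gauss_density, integral_withDensity_eq_integral_toReal_smul meas_dens.ennreal_ofReal
    (ae_of_all _ fun x => by simp)]
  refine integral_congr_ae (ae_of_all _ fun x => ?_)
  simp only [smul_eq_mul]
  rw [ENNReal.toReal_ofReal (Finset.prod_nonneg fun i _ => gaussianPDFReal_nonneg _ _ _)]

lemma integrable_pi_gauss {ι : Type*} [Fintype ι] (f : (ι → ℝ) → ℝ) 
    (hf : Integrable f (Measure.pi fun _ : ι => gaussianReal 0 1)) :
    Integrable (fun x => (∏ i, gaussianPDFReal 0 1 (x i)) * f x) := by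
  rw [pi_gauss_density, integrable_withDensity_iff_integrable_smul' meas_dens.ennreal_ofReal
    (ae_of_all _ fun x => by simp)] at hf
  refine hf.congr (ae_of_all _ fun x => ?_)
  simp only [smul_eq_mul]
  rw [ENNReal.toReal_ofReal (Finset.prod_nonneg fun i _ => gaussianPDFReal_nonneg _ _ _)]

lemma integrable_coord {ι : Type*} [Fintype ι] (i : ι) :
    Integrable (fun x : ι → ℝ => x i) (Measure.pi fun _ : ι => gaussianReal 0 1) := by
  have h : Integrable (fun y : ℝ => y) (gaussianReal 0 1) := by
    have := (memLp_id_gaussianReal' (μ := 0) (v := 1) 1 (by simp))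
    exact memLp_one_iff_integrable.1 this
  exact (measurePreserving_eval (fun _ : ι => gaussianReal 0 1) i).integrable_comp_of_integrable h

lemma hasDerivAt_pdf (x : ℝ) :
    HasDerivAt (gaussianPDFReal 0 1) (- x * gaussianPDFReal 0 1 x) x := by
  have : gaussianPDFReal 0 1 = fun x => (√(2 * Real.pi * (1:NNReal)))⁻¹ * Real.exp (-(x - 0) ^ 2 / (2 * (1:NNReal))) := by
    ext x; rw [gaussianPDFReal]
  rw [this]
  have h := (((((hasDerivAt_id x).sub_const 0).pow 2).neg.div_const (2 * ((1:NNReal):ℝ))).exp).const_mul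
    ((√(2 * Real.pi * (1:NNReal)))⁻¹)
  refine h.congr_deriv ?_
  simp
  ring

/-- Gaussian integration by parts in direction `a`. -/
lemma gauss_ibp {ι : Type*} [Fintype ι] (a : ι → ℝ) (f f' : (ι → ℝ) → ℝ)
    (hf : Continuous f) (hf' : Continuous f') (C C' : ℝ) (hC : ∀ x, |f x| ≤ C)
    (hC' : ∀ x, |f' x| ≤ C')
    (hd : ∀ x, HasDerivAt (fun s : ℝ => f (x + s • a)) (f' x) 0) :
    ∫ x, (a ⬝ᵥ x) * f x ∂(Measure.pi fun _ : ι => gaussianReal 0 1) =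
      ∫ x, f' x ∂(Measure.pi fun _ : ι => gaussianReal 0 1) := by
  classical
  have i1 : Integrable f (Measure.pi fun _ : ι => gaussianReal 0 1) :=
    Integrable.of_bound hf.aestronglyMeasurable C (ae_of_all _ hC)
  have i2 : Integrable f' (Measure.pi fun _ : ι => gaussianReal 0 1) :=
    Integrable.of_bound hf'.aestronglyMeasurable C' (ae_of_all _ hC')
  have i3 : Integrable (fun x => (a ⬝ᵥ x) * f x) (Measure.pi fun _ : ι => gaussianReal 0 1) := by
    refine Integrable.mul_bdd (c := C) ?_ hf.aestronglyMeasurable (ae_of_all _ hC)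
    unfold dotProduct
    exact integrable_finsetSum _ fun i _ => (integrable_coord i).const_mul _
  have hg : ∀ x : ι → ℝ, HasDerivAt (fun s : ℝ => ∏ i, gaussianPDFReal 0 1 ((x + s • a) i))
      (-(a ⬝ᵥ x) * ∏ i, gaussianPDFReal 0 1 (x i)) 0 := by
    intro x
    have h1 : ∀ i ∈ Finset.univ, HasDerivAt (fun s : ℝ => gaussianPDFReal 0 1 ((x + s • a) i))
        (- x i * gaussianPDFReal 0 1 (x i) * a i) 0 := by
      intro i _
      have h2 : HasDerivAt (fun s : ℝ => (x + s • a) i) (a i) 0 := by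
        simpa using ((hasDerivAt_id (0:ℝ)).mul_const (a i)).const_add (x i)
      have h3 := hasDerivAt_pdf ((x + (0:ℝ) • a) i)
      have := HasDerivAt.comp (0:ℝ) h3 h2
      simpa [Function.comp_def] using this
    have := HasDerivAt.fun_finsetProd h1
    refine this.congr_deriv ?_
    rw [dotProduct, ← Finset.sum_neg_distrib, Finset.sum_mul]
    refine Finset.sum_congr rfl fun i hi => ?_
    rw [← Finset.mul_prod_erase _ _ hi]
    simp
    ring
  have key := integral_bilinear_hasLineDerivAt_right_eq_neg_left_of_integrable
    (μ := (volume : Measure (ι → ℝ))) (v := a) (B := ContinuousLinearMap.mul ℝ ℝ)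
    (f := fun x => ∏ i, gaussianPDFReal 0 1 (x i)) (g := f) (g' := f')
    (f' := fun x => -(a ⬝ᵥ x) * ∏ i, gaussianPDFReal 0 1 (x i))
    (by simpa [mul_comm, mul_assoc, mul_left_comm] using (integrable_pi_gauss _ i3).neg)
    (by simpa using integrable_pi_gauss _ i2) (by simpa using integrable_pi_gauss _ i1)
    (fun x _ => hg x) (fun x _ => hd x)
  rw [integral_pi_gauss, integral_pi_gauss]
  simp only [ContinuousLinearMap.mul_apply'] at key
  rw [key, ← integral_neg]
  congr 1; ext x; ring


section Comparison
variable {κ τ : Type*} [Fintype κ] [Fintype τ]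

noncomputable def gRho (η : ℝ) (z : τ → ℝ) : ℝ := √(η + ∑ i, z i ^ 2)

noncomputable def gE (η B c : ℝ) (Z : κ → τ → ℝ) (R : κ → ℝ) (w : κ) : ℝ :=
  c * Real.exp (-(B * (gRho η (Z w) + R w)))

noncomputable def gF (η B c : ℝ) (Z : κ → τ → ℝ) (R : κ → ℝ) : ℝ :=
  Real.exp (-∑ w, gE η B c Z R w)

lemma gRho_pos {η : ℝ} (hη : 0 < η) (z : τ → ℝ) : 0 < gRho η z :=
  Real.sqrt_pos.2 (add_pos_of_pos_of_nonneg hη (Finset.sum_nonneg fun i _ => sq_nonneg _))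

lemma gRho_sq {η : ℝ} (hη : 0 < η) (z : τ → ℝ) : gRho η z ^ 2 = η + ∑ i, z i ^ 2 :=
  Real.sq_sqrt (add_pos_of_pos_of_nonneg hη (Finset.sum_nonneg fun i _ => sq_nonneg _)).le

lemma gE_nonneg {η B c : ℝ} (hc : 0 ≤ c) (Z : κ → τ → ℝ) (R : κ → ℝ) (w : κ) :
    0 ≤ gE η B c Z R w := mul_nonneg hc (Real.exp_pos _).le

lemma u_abs_le {η : ℝ} (hη : 0 < η) (z : τ → ℝ) (i : τ) : |z i / gRho η z| ≤ 1 := by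
  rw [abs_div, abs_of_pos (gRho_pos hη z), div_le_one (gRho_pos hη z)]
  apply Real.abs_le_sqrt
  have := Finset.single_le_sum (f := fun i => z i ^ 2) (fun i _ => sq_nonneg _) (Finset.mem_univ i)
  linarith

lemma uu_le {η : ℝ} (hη : 0 < η) (z z' : τ → ℝ) :
    ∑ i, (z i / gRho η z) * (z' i / gRho η z') ≤ 1 := by
  have h1 : ∀ z : τ → ℝ, ∑ i, (z i / gRho η z) ^ 2 ≤ 1 := by
    intro z
    simp_rw [div_pow]
    rw [← Finset.sum_div, div_le_one (pow_pos (gRho_pos hη z) 2), gRho_sq hη]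
    linarith
  have : ∀ i ∈ Finset.univ, (z i / gRho η z) * (z' i / gRho η z') ≤
      ((z i / gRho η z) ^ 2 + (z' i / gRho η z') ^ 2) / 2 := by
    intro i _
    nlinarith [sq_nonneg (z i / gRho η z - z' i / gRho η z')]
  refine (Finset.sum_le_sum this).trans ?_
  rw [← Finset.sum_div, Finset.sum_add_distrib]
  linarith [h1 z, h1 z']

lemma gE_mul_gF_le {η B c : ℝ} (hc : 0 ≤ c) (Z : κ → τ → ℝ) (R : κ → ℝ) (w : κ) :
    gE η B c Z R w * gF η B c Z R ≤ 1 := by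
  have h1 : gE η B c Z R w ≤ ∑ w, gE η B c Z R w :=
    Finset.single_le_sum (fun w _ => gE_nonneg hc Z R w) (Finset.mem_univ w)
  have h2 := Real.add_one_le_exp (∑ w, gE η B c Z R w)
  unfold gF
  rw [Real.exp_neg, ← div_eq_mul_inv, div_le_one (Real.exp_pos _)]
  linarith

lemma gE_gE_mul_gF_le {η B c : ℝ} (hc : 0 ≤ c) (Z : κ → τ → ℝ) (R : κ → ℝ) (w w' : κ) :
    gE η B c Z R w * gE η B c Z R w' * gF η B c Z R ≤ 2 := by
  have h1 : ∀ w, gE η B c Z R w ≤ ∑ w, gE η B c Z R w := fun w =>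
    Finset.single_le_sum (fun w _ => gE_nonneg hc Z R w) (Finset.mem_univ w)
  have h0 : 0 ≤ ∑ w, gE η B c Z R w := Finset.sum_nonneg fun w _ => gE_nonneg hc Z R w
  have h2 := Real.quadratic_le_exp_of_nonneg h0
  unfold gF
  rw [Real.exp_neg, ← div_eq_mul_inv, div_le_iff₀ (Real.exp_pos _)]
  have := mul_le_mul (h1 w) (h1 w') (gE_nonneg hc Z R w') h0
  nlinarith

lemma gF_pos {η B c : ℝ} (Z : κ → τ → ℝ) (R : κ → ℝ) : 0 < gF η B c Z R := Real.exp_pos _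

lemma gF_le_one {η B c : ℝ} (hc : 0 ≤ c) (Z : κ → τ → ℝ) (R : κ → ℝ) : gF η B c Z R ≤ 1 := by
  unfold gF
  rw [Real.exp_le_one_iff, neg_nonpos]
  exact Finset.sum_nonneg fun w _ => gE_nonneg hc Z R w

lemma gF_hasDerivAt {η B c : ℝ} (hη : 0 < η) (Z : ℝ → κ → τ → ℝ) (R : ℝ → κ → ℝ)
    (dZ : κ → τ → ℝ) (dR : κ → ℝ) (s : ℝ)
    (hZ : ∀ w i, HasDerivAt (fun s => Z s w i) (dZ w i) s)
    (hR : ∀ w, HasDerivAt (fun s => R s w) (dR w) s) :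
    HasDerivAt (fun s => gF η B c (Z s) (R s))
      (gF η B c (Z s) (R s) * ∑ w, gE η B c (Z s) (R s) w *
        (B * (∑ i, Z s w i / gRho η (Z s w) * dZ w i + dR w))) s := by
  have hrho : ∀ w, HasDerivAt (fun s => gRho η (Z s w))
      (∑ i, Z s w i / gRho η (Z s w) * dZ w i) s := by
    intro w
    unfold gRho
    have h1 : HasDerivAt (fun s => η + ∑ i, Z s w i ^ 2) (∑ i, 2 * Z s w i * dZ w i) s := by
      refine HasDerivAt.const_add _ ?_
      refine HasDerivAt.fun_sum fun i _ => ?_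
      refine ((hZ w i).pow 2).congr_deriv ?_
      simp
    have hpos : 0 < η + ∑ i, Z s w i ^ 2 :=
      add_pos_of_pos_of_nonneg hη (Finset.sum_nonneg fun i _ => sq_nonneg _)
    refine (h1.sqrt hpos.ne').congr_deriv ?_
    rw [Finset.sum_div]
    refine Finset.sum_congr rfl fun i _ => ?_
    have := (Real.sqrt_pos.2 hpos).ne'
    field_simp
  have hE : ∀ w, HasDerivAt (fun s => gE η B c (Z s) (R s) w)
      (-(gE η B c (Z s) (R s) w * (B * (∑ i, Z s w i / gRho η (Z s w) * dZ w i + dR w)))) s := by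
    intro w
    unfold gE
    refine (((((hrho w).add (hR w)).const_mul B).neg.exp).const_mul c).congr_deriv ?_
    simp only [Pi.add_apply, Pi.neg_apply]
    ring
  unfold gF
  refine ((HasDerivAt.fun_sum fun w _ => hE w).neg.exp).congr_deriv ?_
  simp only [Finset.sum_neg_distrib, neg_neg, Pi.neg_apply]

lemma gRho_continuous {η : ℝ} {X : Type*} [TopologicalSpace X] (Z : X → τ → ℝ)
    (hZ : ∀ i, Continuous fun x => Z x i) : Continuous fun x => gRho η (Z x) := by
  unfold gRho; fun_prop

lemma gE_continuous {η B c : ℝ} {X : Type*} [TopologicalSpace X] (Z : X → κ → τ → ℝ) (R : X → κ → ℝ)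
    (hZ : ∀ w i, Continuous fun x => Z x w i) (hR : ∀ w, Continuous fun x => R x w) (w : κ) :
    Continuous fun x => gE η B c (Z x) (R x) w := by
  have := gRho_continuous (η := η) (fun x => Z x w) (hZ w)
  have := hR w
  unfold gE; fun_prop

lemma gF_continuous {η B c : ℝ} {X : Type*} [TopologicalSpace X] (Z : X → κ → τ → ℝ) (R : X → κ → ℝ)
    (hZ : ∀ w i, Continuous fun x => Z x w i) (hR : ∀ w, Continuous fun x => R x w) :
    Continuous fun x => gF η B c (Z x) (R x) := by
  have := gE_continuous (η := η) (B := B) (c := c) Z R hZ hR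
  unfold gF; fun_prop

end Comparison


section Interp
variable {κ τ ι : Type*} [Fintype κ] [Fintype τ] [Fintype ι]

noncomputable def iZ (a : κ → τ → ι → ℝ) (b : τ → ι → ℝ) (θ : ℝ) (x : ι → ℝ) (w : κ) (i : τ) : ℝ :=
  Real.cos θ * (a w i ⬝ᵥ x) + Real.sin θ * (b i ⬝ᵥ x)

noncomputable def iR (e : ι → ℝ) (h : κ → ι → ℝ) (θ : ℝ) (x : ι → ℝ) (w : κ) : ℝ :=
  Real.cos θ * (e ⬝ᵥ x) + Real.sin θ * (h w ⬝ᵥ x)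

lemma dot_continuous (a : ι → ℝ) : Continuous fun x : ι → ℝ => a ⬝ᵥ x := by
  unfold dotProduct; fun_prop

lemma dot_integrable (a : ι → ℝ) :
    Integrable (fun x => a ⬝ᵥ x) (Measure.pi fun _ : ι => gaussianReal 0 1) := by
  unfold dotProduct
  exact integrable_finsetSum _ fun i _ => (integrable_coord i).const_mul _

lemma iZ_continuous (a : κ → τ → ι → ℝ) (b : τ → ι → ℝ) (θ : ℝ) (w : κ) (i : τ) :
    Continuous fun x => iZ a b θ x w i := by
  have := dot_continuous (a w i)
  have := dot_continuous (b i)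
  unfold iZ; fun_prop

lemma iR_continuous (e : ι → ℝ) (h : κ → ι → ℝ) (θ : ℝ) (w : κ) :
    Continuous fun x => iR e h θ x w := by
  have := dot_continuous e
  have := dot_continuous (h w)
  unfold iR; fun_prop

lemma iZ_add (a : κ → τ → ι → ℝ) (b : τ → ι → ℝ) (θ : ℝ) (x v : ι → ℝ) (s : ℝ) (w : κ) (i : τ) :
    iZ a b θ (x + s • v) w i = iZ a b θ x w i + s * iZ a b θ v w i := by
  unfold iZ; simp only [dotProduct_add, dotProduct_smul, smul_eq_mul]; ring

lemma iR_add (e : ι → ℝ) (h : κ → ι → ℝ) (θ : ℝ) (x v : ι → ℝ) (s : ℝ) (w : κ) :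
    iR e h θ (x + s • v) w = iR e h θ x w + s * iR e h θ v w := by
  unfold iR; simp only [dotProduct_add, dotProduct_smul, smul_eq_mul]; ring

/-- line derivative of F -/
lemma gF_line {η B c : ℝ} (hη : 0 < η) (a : κ → τ → ι → ℝ) (b : τ → ι → ℝ)
    (e : ι → ℝ) (h : κ → ι → ℝ) (θ : ℝ) (x v : ι → ℝ) :
    HasDerivAt (fun s : ℝ => gF η B c (iZ a b θ (x + s • v)) (iR e h θ (x + s • v)))
      (gF η B c (iZ a b θ x) (iR e h θ x) * ∑ w, gE η B c (iZ a b θ x) (iR e h θ x) w *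
        (B * (∑ i, iZ a b θ x w i / gRho η (iZ a b θ x w) * iZ a b θ v w i + iR e h θ v w))) 0 := by
  have := gF_hasDerivAt (B := B) (c := c) hη (fun s => iZ a b θ (x + s • v)) (fun s => iR e h θ (x + s • v))
    (iZ a b θ v) (iR e h θ v) 0
    (fun w i => by
      simp only [iZ_add]
      simpa using ((hasDerivAt_id (0:ℝ)).mul_const (iZ a b θ v w i)).const_add (iZ a b θ x w i))
    (fun w => by
      simp only [iR_add]
      simpa using ((hasDerivAt_id (0:ℝ)).mul_const (iR e h θ v w)).const_add (iR e h θ x w))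
  simpa using this

/-- theta derivative -/
lemma gF_theta {η B c : ℝ} (hη : 0 < η) (a : κ → τ → ι → ℝ) (b : τ → ι → ℝ)
    (e : ι → ℝ) (h : κ → ι → ℝ) (θ : ℝ) (x : ι → ℝ) :
    HasDerivAt (fun θ : ℝ => gF η B c (iZ a b θ x) (iR e h θ x))
      (gF η B c (iZ a b θ x) (iR e h θ x) * ∑ w, gE η B c (iZ a b θ x) (iR e h θ x) w *
        (B * (∑ i, iZ a b θ x w i / gRho η (iZ a b θ x w) *
          ((-Real.sin θ • a w i + Real.cos θ • b i) ⬝ᵥ x) +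
          ((-Real.sin θ • e + Real.cos θ • h w) ⬝ᵥ x)))) θ := by
  refine gF_hasDerivAt (B := B) (c := c) hη (fun θ => iZ a b θ x) (fun θ => iR e h θ x) _ _ θ ?_ ?_
  · intro w i
    unfold iZ
    refine (((Real.hasDerivAt_cos θ).mul_const _).add ((Real.hasDerivAt_sin θ).mul_const _)).congr_deriv ?_
    simp only [add_dotProduct, smul_dotProduct, smul_eq_mul]
  · intro w
    unfold iR
    refine (((Real.hasDerivAt_cos θ).mul_const _).add ((Real.hasDerivAt_sin θ).mul_const _)).congr_deriv ?_
    simp only [add_dotProduct, smul_dotProduct, smul_eq_mul]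

variable [DecidableEq τ]

structure GordonData (a : κ → τ → ι → ℝ) (b : τ → ι → ℝ) (e : ι → ℝ) (h : κ → ι → ℝ)
    (K : κ → κ → ℝ) : Prop where
  haa : ∀ w i w' i', a w i ⬝ᵥ a w' i' = if i = i' then K w w' else 0
  hbb : ∀ i i', b i ⬝ᵥ b i' = if i = i' then 1 else 0
  hab : ∀ w i i', a w i ⬝ᵥ b i' = 0
  hae : ∀ w i, a w i ⬝ᵥ e = 0
  hah : ∀ w i w', a w i ⬝ᵥ h w' = 0
  hbe : ∀ i, b i ⬝ᵥ e = 0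
  hbh : ∀ i w, b i ⬝ᵥ h w = 0
  hee : e ⬝ᵥ e = 1
  heh : ∀ w, e ⬝ᵥ h w = 0
  hhh : ∀ w w', h w ⬝ᵥ h w' = K w w'
  hK1 : ∀ w, K w w = 1
  hKs : ∀ w w', K w w' = K w' w
  hK : ∀ w w', K w w' ≤ 1

variable {a : κ → τ → ι → ℝ} {b : τ → ι → ℝ} {e : ι → ℝ} {h : κ → ι → ℝ} {K : κ → κ → ℝ}

lemma iZ_p' (H : GordonData a b e h K) (θ : ℝ) (w w' : κ) (i i' : τ) :
    iZ a b θ (-Real.sin θ • a w i + Real.cos θ • b i) w' i' =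
      if i' = i then Real.sin θ * Real.cos θ * (1 - K w w') else 0 := by
  unfold iZ
  simp only [dotProduct_add, dotProduct_smul, smul_eq_mul, H.haa, H.hbb, H.hab,
    dotProduct_comm (b i') (a w i)]
  split_ifs with hi
  · rw [H.hKs w' w]; ring
  · ring

lemma iR_p' (H : GordonData a b e h K) (θ : ℝ) (w w' : κ) (i : τ) :
    iR e h θ (-Real.sin θ • a w i + Real.cos θ • b i) w' = 0 := by
  unfold iR
  simp only [add_dotProduct, smul_dotProduct, smul_eq_mul, dotProduct_comm e, dotProduct_comm (h _),
    H.hae, H.hah, H.hbe, H.hbh]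
  ring

lemma iZ_r' (H : GordonData a b e h K) (θ : ℝ) (w w' : κ) (i' : τ) :
    iZ a b θ (-Real.sin θ • e + Real.cos θ • h w) w' i' = 0 := by
  unfold iZ
  simp only [dotProduct_add, dotProduct_smul, smul_eq_mul, 
    H.hae, H.hah, H.hbe, H.hbh]
  ring

lemma iR_r' (H : GordonData a b e h K) (θ : ℝ) (w w' : κ) :
    iR e h θ (-Real.sin θ • e + Real.cos θ • h w) w' = - (Real.sin θ * Real.cos θ * (1 - K w w')) := by
  unfold iR
  simp only [dotProduct_add, dotProduct_smul, smul_eq_mul, dotProduct_comm (h _) e,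
    H.hee, H.heh, H.hhh]
  rw [H.hKs w' w]; ring

lemma abs4 {E F u C : ℝ} (hE : 0 ≤ E) (hF : 0 ≤ F) (hEF : E * F ≤ C) (hu : |u| ≤ 1) :
    |E * F * u| ≤ C := by
  rw [abs_mul, abs_of_nonneg (mul_nonneg hE hF)]
  calc E * F * |u| ≤ E * F * 1 := by gcongr
    _ ≤ C := by linarith

lemma ibp_Z {η B c : ℝ} (hη : 0 < η) (hB : 0 ≤ B) (hc : 0 ≤ c) (H : GordonData a b e h K) (θ : ℝ) (w : κ) (i : τ) :
    ∫ x, ((-Real.sin θ • a w i + Real.cos θ • b i) ⬝ᵥ x) *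
        (gF η B c (iZ a b θ x) (iR e h θ x) * (gE η B c (iZ a b θ x) (iR e h θ x) w * 
          (iZ a b θ x w i / gRho η (iZ a b θ x w))))
        ∂(Measure.pi fun _ : ι => gaussianReal 0 1) =
    ∫ x, ∑ w', (Real.sin θ * Real.cos θ * (1 - K w w')) * B * 
        (gE η B c (iZ a b θ x) (iR e h θ x) w * gE η B c (iZ a b θ x) (iR e h θ x) w' * 
          gF η B c (iZ a b θ x) (iR e h θ x) *
          ((iZ a b θ x w i / gRho η (iZ a b θ x w)) * (iZ a b θ x w' i / gRho η (iZ a b θ x w'))))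
        ∂(Measure.pi fun _ : ι => gaussianReal 0 1) := by
  have cF := gF_continuous (η := η) (B := B) (c := c) (fun x => iZ a b θ x) (fun x => iR e h θ x)
      (iZ_continuous a b θ) (iR_continuous e h θ)
  have cE := gE_continuous (η := η) (B := B) (c := c) (fun x => iZ a b θ x) (fun x => iR e h θ x)
      (iZ_continuous a b θ) (iR_continuous e h θ)
  have cU : ∀ w i, Continuous fun x => iZ a b θ x w i / gRho η (iZ a b θ x w) := fun w i =>
    (iZ_continuous a b θ w i).div (gRho_continuous (fun x => iZ a b θ x w) (iZ_continuous a b θ w))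
      fun x => (gRho_pos hη _).ne'
  refine gauss_ibp _ _ _ ?_ ?_ 1 (∑ w', |Real.sin θ * Real.cos θ * (1 - K w w') * B| * 2) ?_ ?_ ?_
  · have := cE w; have := cU w i
    fun_prop
  · refine continuous_finsetSum _ fun w' _ => ?_
    have := cE w; have := cU w i; have := cE w'; have := cU w' i
    fun_prop
  · intro x
    have := abs4 (gE_nonneg hc (iZ a b θ x) (iR e h θ x) w) (gF_pos (η := η) (B := B) (c := c) (iZ a b θ x) (iR e h θ x)).le
      (gE_mul_gF_le hc (iZ a b θ x) (iR e h θ x) w) (u_abs_le hη (iZ a b θ x w) i)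
    convert this using 2
    ring
  · intro x
    refine (Finset.abs_sum_le_sum_abs _ _).trans (Finset.sum_le_sum fun w' _ => ?_)
    rw [abs_mul]
    refine mul_le_mul_of_nonneg_left ?_ (abs_nonneg _)
    refine abs4 (mul_nonneg (gE_nonneg hc _ _ w) (gE_nonneg hc _ _ w')) (gF_pos _ _).le
      (gE_gE_mul_gF_le hc _ _ w w') ?_
    rw [abs_mul]
    exact mul_le_one₀ (u_abs_le hη _ i) (abs_nonneg _) (u_abs_le hη _ i)
  · intro x
    set v := (-Real.sin θ • a w i + Real.cos θ • b i) with hv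
    have hz : ∀ s : ℝ, iZ a b θ (x + s • v) w = iZ a b θ x w := by
      intro s; ext i'
      rw [iZ_add, hv, iZ_p' H, H.hK1]; simp
    have hr : ∀ s : ℝ, iR e h θ (x + s • v) w = iR e h θ x w := by
      intro s
      rw [iR_add, hv, iR_p' H]; simp
    have hE : ∀ s : ℝ, gE η B c (iZ a b θ (x + s • v)) (iR e h θ (x + s • v)) w =
        gE η B c (iZ a b θ x) (iR e h θ x) w := by
      intro s; unfold gE; rw [hz, hr]
    simp only [hE, hz]
    refine ((gF_line hη a b e h θ x v).mul_const _).congr_deriv ?_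
    simp only [hv, iZ_p' H, iR_p' H, mul_ite, mul_zero, Finset.sum_ite_eq', Finset.mem_univ, if_true, add_zero]
    rw [Finset.mul_sum, Finset.sum_mul]
    refine Finset.sum_congr rfl fun w' _ => ?_
    ring

lemma ibp_R {η B c : ℝ} (hη : 0 < η) (hB : 0 ≤ B) (hc : 0 ≤ c) (H : GordonData a b e h K) (θ : ℝ) (w : κ) :
    ∫ x, ((-Real.sin θ • e + Real.cos θ • h w) ⬝ᵥ x) *
        (gF η B c (iZ a b θ x) (iR e h θ x) * gE η B c (iZ a b θ x) (iR e h θ x) w)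
        ∂(Measure.pi fun _ : ι => gaussianReal 0 1) =
    ∫ x, ∑ w', (-(Real.sin θ * Real.cos θ * (1 - K w w')) * B) * 
        (gE η B c (iZ a b θ x) (iR e h θ x) w * gE η B c (iZ a b θ x) (iR e h θ x) w' * 
          gF η B c (iZ a b θ x) (iR e h θ x))
        ∂(Measure.pi fun _ : ι => gaussianReal 0 1) := by
  have cF := gF_continuous (η := η) (B := B) (c := c) (fun x => iZ a b θ x) (fun x => iR e h θ x)
      (iZ_continuous a b θ) (iR_continuous e h θ)
  have cE := gE_continuous (η := η) (B := B) (c := c) (fun x => iZ a b θ x) (fun x => iR e h θ x)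
      (iZ_continuous a b θ) (iR_continuous e h θ)
  refine gauss_ibp _ _ _ ?_ ?_ 1 (∑ w', |-(Real.sin θ * Real.cos θ * (1 - K w w')) * B| * 2) ?_ ?_ ?_
  · have := cE w
    fun_prop
  · refine continuous_finsetSum _ fun w' _ => ?_
    have := cE w; have := cE w'
    fun_prop
  · intro x
    have := abs4 (u := 1) (gE_nonneg hc (iZ a b θ x) (iR e h θ x) w) (gF_pos (η := η) (B := B) (c := c) (iZ a b θ x) (iR e h θ x)).le
      (gE_mul_gF_le hc (iZ a b θ x) (iR e h θ x) w) (by simp)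
    convert this using 2
    ring
  · intro x
    refine (Finset.abs_sum_le_sum_abs _ _).trans (Finset.sum_le_sum fun w' _ => ?_)
    rw [abs_mul]
    refine mul_le_mul_of_nonneg_left ?_ (abs_nonneg _)
    have := abs4 (u := 1) (mul_nonneg (gE_nonneg hc (iZ a b θ x) (iR e h θ x) w) (gE_nonneg hc (iZ a b θ x) (iR e h θ x) w')) (gF_pos _ _).le
      (gE_gE_mul_gF_le (η := η) (B := B) hc _ _ w w') (by simp)
    simpa using this
  · intro x
    set v := (-Real.sin θ • e + Real.cos θ • h w) with hv
    have hz : ∀ s : ℝ, iZ a b θ (x + s • v) w = iZ a b θ x w := by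
      intro s; ext i'
      rw [iZ_add, hv, iZ_r' H]; simp
    have hr : ∀ s : ℝ, iR e h θ (x + s • v) w = iR e h θ x w := by
      intro s
      rw [iR_add, hv, iR_r' H, H.hK1]; simp
    have hE : ∀ s : ℝ, gE η B c (iZ a b θ (x + s • v)) (iR e h θ (x + s • v)) w =
        gE η B c (iZ a b θ x) (iR e h θ x) w := by
      intro s; unfold gE; rw [hz, hr]
    simp only [hE]
    refine ((gF_line hη a b e h θ x v).mul_const _).congr_deriv ?_
    simp only [hv, iZ_r' H, iR_r' H, mul_zero, Finset.sum_const_zero, zero_add]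
    rw [Finset.mul_sum, Finset.sum_mul]
    refine Finset.sum_congr rfl fun w' _ => ?_
    ring

end Interp


section Gordon
variable {κ τ ι : Type*} [Fintype κ] [Fintype τ] [Fintype ι] [DecidableEq τ]
variable {a : κ → τ → ι → ℝ} {b : τ → ι → ℝ} {e : ι → ℝ} {h : κ → ι → ℝ} {K : κ → κ → ℝ}

lemma gordon_deriv {η B c : ℝ} (hη : 0 < η) (hB : 0 ≤ B) (hc : 0 ≤ c) (H : GordonData a b e h K) (θ : ℝ)
    (hθ : 0 ≤ Real.sin θ * Real.cos θ) :
    ∃ d ≤ 0, HasDerivAt (fun θ => ∫ x, gF η B c (iZ a b θ x) (iR e h θ x)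
      ∂(Measure.pi fun _ : ι => gaussianReal 0 1)) d θ := by
  set γ := (Measure.pi fun _ : ι => gaussianReal 0 1) with hγ
  have cF := fun θ => gF_continuous (η := η) (B := B) (c := c) (fun x => iZ a b θ x) (fun x => iR e h θ x)
      (iZ_continuous a b θ) (iR_continuous e h θ)
  have cE := fun θ => gE_continuous (η := η) (B := B) (c := c) (fun x => iZ a b θ x) (fun x => iR e h θ x)
      (iZ_continuous a b θ) (iR_continuous e h θ)
  have cU : ∀ θ w i, Continuous fun x => iZ a b θ x w i / gRho η (iZ a b θ x w) := fun θ w i =>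
    (iZ_continuous a b θ w i).div (gRho_continuous (fun x => iZ a b θ x w) (iZ_continuous a b θ w))
      fun x => (gRho_pos hη _).ne'
  have hdiff := (hasDerivAt_integral_of_dominated_loc_of_deriv_le (μ := γ) (s := Set.univ) (x₀ := θ)
    (F := fun θ x => gF η B c (iZ a b θ x) (iR e h θ x))
    (F' := fun θ x => (gF η B c (iZ a b θ x) (iR e h θ x) * ∑ w, gE η B c (iZ a b θ x) (iR e h θ x) w *
        (B * (∑ i, iZ a b θ x w i / gRho η (iZ a b θ x w) *
          ((-Real.sin θ • a w i + Real.cos θ • b i) ⬝ᵥ x) +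
          ((-Real.sin θ • e + Real.cos θ • h w) ⬝ᵥ x)))))
    (bound := fun x => ∑ w, B * (∑ i, (|a w i ⬝ᵥ x| + |b i ⬝ᵥ x|) + (|e ⬝ᵥ x| + |h w ⬝ᵥ x|)))
    Filter.univ_mem
    (Filter.Eventually.of_forall fun θ => (cF θ).aestronglyMeasurable)
    (Integrable.of_bound (cF θ).aestronglyMeasurable 1 (ae_of_all _ fun x => by
      rw [Real.norm_eq_abs, abs_of_pos (gF_pos _ _)]; exact gF_le_one hc _ _))
    (by
      refine Continuous.aestronglyMeasurable ?_
      refine (cF θ).mul (continuous_finsetSum _ fun w _ => (cE θ w).mul (continuous_const.mul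
        (Continuous.add (continuous_finsetSum _ fun i _ => (cU θ w i).mul (dot_continuous _)) (dot_continuous _)))))
    (ae_of_all _ fun x θ _ => by
      rw [Finset.mul_sum]
      refine (norm_sum_le _ _).trans (Finset.sum_le_sum fun w _ => ?_)
      have hsc : ∀ p q : ℝ, |-Real.sin θ * p + Real.cos θ * q| ≤ |p| + |q| := by
        intro p q
        refine (abs_add_le _ _).trans ?_
        rw [abs_mul, abs_mul, abs_neg]
        have := Real.abs_sin_le_one θ
        have := Real.abs_cos_le_one θ
        nlinarith [abs_nonneg p, abs_nonneg q]
      have h1 := gE_mul_gF_le (η := η) (B := B) hc (iZ a b θ x) (iR e h θ x) w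
      have h2 := gE_nonneg (η := η) (B := B) hc (iZ a b θ x) (iR e h θ x) w
      have h3 := (gF_pos (η := η) (B := B) (c := c) (iZ a b θ x) (iR e h θ x)).le
      have h4 : |∑ i, iZ a b θ x w i / gRho η (iZ a b θ x w) *
          ((-Real.sin θ • a w i + Real.cos θ • b i) ⬝ᵥ x) +
          ((-Real.sin θ • e + Real.cos θ • h w) ⬝ᵥ x)| ≤ 
          ∑ i, (|a w i ⬝ᵥ x| + |b i ⬝ᵥ x|) + (|e ⬝ᵥ x| + |h w ⬝ᵥ x|) := by
        refine (abs_add_le _ _).trans (add_le_add ?_ ?_)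
        · refine (Finset.abs_sum_le_sum_abs _ _).trans (Finset.sum_le_sum fun i _ => ?_)
          rw [abs_mul]
          simp only [add_dotProduct, smul_dotProduct, smul_eq_mul]
          have h5 := u_abs_le hη (iZ a b θ x w) i
          have h6 := hsc (a w i ⬝ᵥ x) (b i ⬝ᵥ x)
          nlinarith [abs_nonneg (-Real.sin θ * (a w i ⬝ᵥ x) + Real.cos θ * (b i ⬝ᵥ x))]
        · simp only [add_dotProduct, smul_dotProduct, smul_eq_mul]
          exact hsc _ _
      rw [← mul_assoc, norm_mul, norm_mul _ (_ + _), Real.norm_eq_abs, Real.norm_eq_abs, Real.norm_eq_abs,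
        abs_of_nonneg (mul_nonneg h3 h2), abs_of_nonneg hB]
      have h7 := mul_le_mul_of_nonneg_left h4 hB
      have h8 := mul_nonneg hB (abs_nonneg (∑ i, iZ a b θ x w i / gRho η (iZ a b θ x w) *
          ((-Real.sin θ • a w i + Real.cos θ • b i) ⬝ᵥ x) +
          ((-Real.sin θ • e + Real.cos θ • h w) ⬝ᵥ x)))
      nlinarith)
    (by
      refine integrable_finsetSum _ fun w _ => Integrable.const_mul (Integrable.add
        (integrable_finsetSum _ fun i _ => ?_) ?_) _
      · exact (dot_integrable _).abs.add (dot_integrable _).abs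
      · exact (dot_integrable _).abs.add (dot_integrable _).abs)
    (ae_of_all _ fun x θ _ => gF_theta hη a b e h θ x)).2
  refine ⟨_, ?_, hdiff⟩
  have bF : ∀ x w, |gF η B c (iZ a b θ x) (iR e h θ x) * gE η B c (iZ a b θ x) (iR e h θ x) w| ≤ 1 := by
    intro x w
    rw [abs_of_nonneg (mul_nonneg (gF_pos _ _).le (gE_nonneg hc _ _ w)), mul_comm]
    exact gE_mul_gF_le hc _ _ w
  have iR' : ∀ w, Integrable (fun x => ((-Real.sin θ • e + Real.cos θ • h w) ⬝ᵥ x) *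
        (gF η B c (iZ a b θ x) (iR e h θ x) * gE η B c (iZ a b θ x) (iR e h θ x) w)) γ := by
    intro w
    refine Integrable.mul_bdd (c := 1) (dot_integrable _) ?_ (ae_of_all _ fun x => ?_)
    · exact ((cF θ).mul (cE θ w)).aestronglyMeasurable
    · exact bF x w
  have iZ' : ∀ w i, Integrable (fun x => ((-Real.sin θ • a w i + Real.cos θ • b i) ⬝ᵥ x) *
        (gF η B c (iZ a b θ x) (iR e h θ x) * (gE η B c (iZ a b θ x) (iR e h θ x) w * 
          (iZ a b θ x w i / gRho η (iZ a b θ x w))))) γ := by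
    intro w i
    refine Integrable.mul_bdd (c := 1) (dot_integrable _) ?_ (ae_of_all _ fun x => ?_)
    · exact ((cF θ).mul ((cE θ w).mul (cU θ w i))).aestronglyMeasurable
    · rw [← mul_assoc, norm_mul]
      exact mul_le_one₀ (bF x w) (norm_nonneg _) (u_abs_le hη _ i)
  have bEE : ∀ x w w', |gE η B c (iZ a b θ x) (iR e h θ x) w * gE η B c (iZ a b θ x) (iR e h θ x) w' * 
          gF η B c (iZ a b θ x) (iR e h θ x)| ≤ 2 := by
    intro x w w'
    rw [abs_of_nonneg (mul_nonneg (mul_nonneg (gE_nonneg hc _ _ w) (gE_nonneg hc _ _ w')) (gF_pos _ _).le)]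
    exact gE_gE_mul_gF_le hc _ _ w w'
  have jR : ∀ w, Integrable (fun x => ∑ w', (-(Real.sin θ * Real.cos θ * (1 - K w w')) * B) * 
        (gE η B c (iZ a b θ x) (iR e h θ x) w * gE η B c (iZ a b θ x) (iR e h θ x) w' * 
          gF η B c (iZ a b θ x) (iR e h θ x))) γ := by
    intro w
    refine integrable_finsetSum _ fun w' _ => Integrable.const_mul ?_ _
    exact Integrable.of_bound (((cE θ w).mul (cE θ w')).mul (cF θ)).aestronglyMeasurable 2 (ae_of_all _ fun x => bEE x w w')
  have jZ : ∀ w i, Integrable (fun x => ∑ w', (Real.sin θ * Real.cos θ * (1 - K w w')) * B * 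
        (gE η B c (iZ a b θ x) (iR e h θ x) w * gE η B c (iZ a b θ x) (iR e h θ x) w' * 
          gF η B c (iZ a b θ x) (iR e h θ x) *
          ((iZ a b θ x w i / gRho η (iZ a b θ x w)) * (iZ a b θ x w' i / gRho η (iZ a b θ x w'))))) γ := by
    intro w i
    refine integrable_finsetSum _ fun w' _ => Integrable.const_mul ?_ _
    refine Integrable.of_bound ((((cE θ w).mul (cE θ w')).mul (cF θ)).mul ((cU θ w i).mul (cU θ w' i))).aestronglyMeasurable 2 (ae_of_all _ fun x => ?_)
    rw [norm_mul, norm_mul (_ / _)]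
    have h1 := bEE x w w'
    have h2 := mul_le_one₀ (u_abs_le hη (iZ a b θ x w) i) (abs_nonneg _) (u_abs_le hη (iZ a b θ x w') i)
    simp only [Real.norm_eq_abs]
    calc _ ≤ (2:ℝ) * 1 := mul_le_mul h1 h2 (by positivity) (by norm_num)
      _ = 2 := by norm_num
  have step1 : ∀ x, (gF η B c (iZ a b θ x) (iR e h θ x) * ∑ w, gE η B c (iZ a b θ x) (iR e h θ x) w *
        (B * (∑ i, iZ a b θ x w i / gRho η (iZ a b θ x w) *
          ((-Real.sin θ • a w i + Real.cos θ • b i) ⬝ᵥ x) +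
          ((-Real.sin θ • e + Real.cos θ • h w) ⬝ᵥ x)))) = 
      B * ∑ w, (∑ i, ((-Real.sin θ • a w i + Real.cos θ • b i) ⬝ᵥ x) *
        (gF η B c (iZ a b θ x) (iR e h θ x) * (gE η B c (iZ a b θ x) (iR e h θ x) w * 
          (iZ a b θ x w i / gRho η (iZ a b θ x w)))) + 
        ((-Real.sin θ • e + Real.cos θ • h w) ⬝ᵥ x) *
        (gF η B c (iZ a b θ x) (iR e h θ x) * gE η B c (iZ a b θ x) (iR e h θ x) w)) := by
    intro x
    rw [Finset.mul_sum, Finset.mul_sum]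
    refine Finset.sum_congr rfl fun w _ => ?_
    rw [mul_add, mul_add, mul_add, mul_add, Finset.mul_sum, Finset.mul_sum, Finset.mul_sum, Finset.mul_sum]
    congr 1
    · refine Finset.sum_congr rfl fun i _ => ?_
      ring
    · ring
  simp_rw [step1]
  rw [integral_const_mul]
  refine mul_nonpos_of_nonneg_of_nonpos hB ?_
  rw [integral_finsetSum]
  swap
  · intro w _
    exact (integrable_finsetSum _ fun i _ => iZ' w i).add (iR' w)
  refine Finset.sum_nonpos fun w _ => ?_
  rw [integral_add (integrable_finsetSum _ fun i _ => iZ' w i) (iR' w), integral_finsetSum _ fun i _ => iZ' w i,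
    ibp_R hη hB hc H, Finset.sum_congr rfl fun i _ => ibp_Z hη hB hc H θ w i, ← integral_finsetSum _ fun i _ => jZ w i,
    ← integral_add (integrable_finsetSum _ fun i _ => jZ w i) (jR w)]
  refine integral_nonpos fun x => ?_
  simp only [Pi.zero_apply]
  rw [Finset.sum_comm, ← Finset.sum_add_distrib]
  refine Finset.sum_nonpos fun w' _ => ?_
  rw [← Finset.mul_sum, ← Finset.mul_sum]
  have h1 := uu_le hη (iZ a b θ x w) (iZ a b θ x w')
  have h2 := mul_nonneg (mul_nonneg (gE_nonneg (η := η) (B := B) hc (iZ a b θ x) (iR e h θ x) w)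
    (gE_nonneg (η := η) (B := B) hc (iZ a b θ x) (iR e h θ x) w')) (gF_pos (η := η) (B := B) (c := c) (iZ a b θ x) (iR e h θ x)).le
  have h3 : 0 ≤ Real.sin θ * Real.cos θ * (1 - K w w') * B :=
    mul_nonneg (mul_nonneg hθ (by linarith [H.hK w w'])) hB
  have h4 := mul_nonneg h3 (mul_nonneg h2 (sub_nonneg.2 h1))
  linarith

lemma gordon_compare {η B c : ℝ} (hη : 0 < η) (hB : 0 ≤ B) (hc : 0 ≤ c) (H : GordonData a b e h K) :
    ∫ x, gF η B c (fun (_ : κ) i => b i ⬝ᵥ x) (fun w => h w ⬝ᵥ x) ∂(Measure.pi fun _ : ι => gaussianReal 0 1) ≤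
    ∫ x, gF η B c (fun w i => a w i ⬝ᵥ x) (fun _ => e ⬝ᵥ x) ∂(Measure.pi fun _ : ι => gaussianReal 0 1) := by
  have hsc : ∀ θ ∈ Set.Icc (0:ℝ) (Real.pi / 2), 0 ≤ Real.sin θ * Real.cos θ := by
    intro θ hθ
    have := Real.pi_pos
    exact mul_nonneg (Real.sin_nonneg_of_nonneg_of_le_pi hθ.1 (by linarith [hθ.2]))
      (Real.cos_nonneg_of_mem_Icc ⟨by linarith [hθ.1], hθ.2⟩)
  have anti : AntitoneOn (fun θ => ∫ x, gF η B c (iZ a b θ x) (iR e h θ x)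
      ∂(Measure.pi fun _ : ι => gaussianReal 0 1)) (Set.Icc 0 (Real.pi / 2)) := by
    refine antitoneOn_of_deriv_nonpos (convex_Icc _ _) ?_ ?_ ?_
    · intro θ hθ
      obtain ⟨d, _, hd⟩ := gordon_deriv hη hB hc H θ (hsc θ hθ)
      exact hd.continuousAt.continuousWithinAt
    · intro θ hθ
      obtain ⟨d, _, hd⟩ := gordon_deriv hη hB hc H θ (hsc θ (interior_subset hθ))
      exact hd.differentiableAt.differentiableWithinAt
    · intro θ hθ
      obtain ⟨d, hd0, hd⟩ := gordon_deriv hη hB hc H θ (hsc θ (interior_subset hθ))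
      rw [hd.deriv]; exact hd0
  have hpi := Real.pi_pos
  have := anti (Set.left_mem_Icc.2 (by positivity)) (Set.right_mem_Icc.2 (by positivity)) (by positivity : (0:ℝ) ≤ Real.pi / 2)
  have e1 : ∀ x, iZ a b 0 x = (fun w i => a w i ⬝ᵥ x) := by intro x; ext w i; simp [iZ]
  have e2 : ∀ x, iR e h 0 x = (fun w => e ⬝ᵥ x) := by intro x; ext w; simp [iR]
  have e3 : ∀ x, iZ a b (Real.pi / 2) x = (fun w i => b i ⬝ᵥ x) := by intro x; ext w i; simp [iZ]
  have e4 : ∀ x, iR e h (Real.pi / 2) x = (fun w => h w ⬝ᵥ x) := by intro x; ext w; simp [iR]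
  simpa only [e1, e2, e3, e4] using this

end Gordon


section GordonProb
variable {κ τ ι : Type*} [Fintype κ] [Fintype τ] [Fintype ι] [DecidableEq τ]
variable {a : κ → τ → ι → ℝ} {b : τ → ι → ℝ} {e : ι → ℝ} {h : κ → ι → ℝ} {K : κ → κ → ℝ}

lemma gE_shift {η B t : ℝ} (Z : κ → τ → ℝ) (R : κ → ℝ) (w : κ) :
    gE η B (Real.exp (B * t)) Z R w = Real.exp (-(B * (gRho η (Z w) + R w - t))) := by
  unfold gE; rw [← Real.exp_add]; congr 1; ring

lemma gordon_prob_B {η t δ B : ℝ} (hη : 0 < η) (hB : 0 < B) (H : GordonData a b e h K) :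
    Real.exp (-((Fintype.card κ : ℝ) * Real.exp (-(B * δ)))) *
      (Measure.pi fun _ : ι => gaussianReal 0 1).real {x | ∃ w, gRho η (fun i => b i ⬝ᵥ x) + h w ⬝ᵥ x < t + δ}ᶜ ≤
    (Measure.pi fun _ : ι => gaussianReal 0 1).real {x | ∃ w, gRho η (fun i => a w i ⬝ᵥ x) + e ⬝ᵥ x ≤ t - δ}ᶜ +
      Real.exp (-Real.exp (B * δ)) := by
  set γ := (Measure.pi fun _ : ι => gaussianReal 0 1) with hγ
  have hc : 0 ≤ Real.exp (B * t) := (Real.exp_pos _).le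
  have key := gordon_compare (B := B) hη hB.le hc H
  have cX := gF_continuous (η := η) (B := B) (c := Real.exp (B * t)) (fun x w i => a w i ⬝ᵥ x) (fun x (_:κ) => e ⬝ᵥ x)
    (fun w i => dot_continuous _) (fun w => dot_continuous _)
  have cY := gF_continuous (η := η) (B := B) (c := Real.exp (B * t)) (fun x (_:κ) i => b i ⬝ᵥ x) (fun x w => h w ⬝ᵥ x)
    (fun w i => dot_continuous _) (fun w => dot_continuous _)
  have iX : Integrable (fun x => gF η B (Real.exp (B * t)) (fun w i => a w i ⬝ᵥ x) (fun _ => e ⬝ᵥ x)) γ :=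
    Integrable.of_bound cX.aestronglyMeasurable 1 (ae_of_all _ fun x => by
      rw [Real.norm_eq_abs, abs_of_pos (gF_pos _ _)]; exact gF_le_one hc _ _)
  have iY : Integrable (fun x => gF η B (Real.exp (B * t)) (fun (_:κ) i => b i ⬝ᵥ x) (fun w => h w ⬝ᵥ x)) γ :=
    Integrable.of_bound cY.aestronglyMeasurable 1 (ae_of_all _ fun x => by
      rw [Real.norm_eq_abs, abs_of_pos (gF_pos _ _)]; exact gF_le_one hc _ _)
  have mX : MeasurableSet {x : ι → ℝ | ∃ w, gRho η (fun i => a w i ⬝ᵥ x) + e ⬝ᵥ x ≤ t - δ} := by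
    rw [Set.ofPred_exists]
    refine MeasurableSet.iUnion fun w => (IsClosed.measurableSet ?_)
    exact isClosed_le ((gRho_continuous _ fun i => dot_continuous _).add (dot_continuous _)) continuous_const
  have mY : MeasurableSet {x : ι → ℝ | ∃ w, gRho η (fun i => b i ⬝ᵥ x) + h w ⬝ᵥ x < t + δ} := by
    rw [Set.ofPred_exists]
    refine MeasurableSet.iUnion fun w => (IsOpen.measurableSet ?_)
    exact isOpen_lt ((gRho_continuous _ fun i => dot_continuous _).add (dot_continuous _)) continuous_const
  refine le_trans (le_trans ?_ key) ?_
  · rw [← integral_indicator_one mY.compl, ← integral_const_mul]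
    refine integral_mono (((integrable_const (1:ℝ)).indicator mY.compl).const_mul _) iY fun x => ?_
    by_cases hx : x ∈ {x : ι → ℝ | ∃ w, gRho η (fun i => b i ⬝ᵥ x) + h w ⬝ᵥ x < t + δ}ᶜ
    · simp only [Set.indicator_of_mem hx, Pi.one_apply, mul_one]
      unfold gF
      refine Real.exp_le_exp.2 (neg_le_neg ?_)
      rw [← nsmul_eq_mul, ← Finset.card_univ]
      refine Finset.sum_le_card_nsmul _ _ _ fun w _ => ?_
      rw [gE_shift]
      refine Real.exp_le_exp.2 (neg_le_neg (mul_le_mul_of_nonneg_left ?_ hB.le))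
      simp only [Set.mem_compl_iff, Set.mem_ofPred_eq, not_exists, not_lt] at hx
      linarith [hx w]
    · simp only [Set.indicator_of_notMem hx, mul_zero]
      exact (gF_pos _ _).le
  · rw [← integral_indicator_one mX.compl]
    have : Real.exp (-Real.exp (B * δ)) = ∫ x, Real.exp (-Real.exp (B * δ)) ∂γ := by simp
    have hi : Integrable ({x : ι → ℝ | ∃ w, gRho η (fun i => a w i ⬝ᵥ x) + e ⬝ᵥ x ≤ t - δ}ᶜ.indicator (1 : (ι → ℝ) → ℝ)) γ :=
      (integrable_const (1:ℝ)).indicator mX.compl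
    rw [this, ← integral_add hi (integrable_const _)]
    refine integral_mono iX (hi.add (integrable_const _)) fun x => ?_
    by_cases hx : x ∈ {x : ι → ℝ | ∃ w, gRho η (fun i => a w i ⬝ᵥ x) + e ⬝ᵥ x ≤ t - δ}ᶜ
    · simp only [Set.indicator_of_mem hx, Pi.one_apply]
      have := gF_le_one (η := η) (B := B) hc (fun w i => a w i ⬝ᵥ x) (fun (_ : κ) => e ⬝ᵥ x)
      linarith [Real.exp_pos (-Real.exp (B * δ))]
    · simp only [Set.indicator_of_notMem hx, zero_add]
      unfold gF
      refine Real.exp_le_exp.2 (neg_le_neg ?_)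
      simp only [Set.mem_compl_iff, Set.mem_ofPred_eq, not_not] at hx
      obtain ⟨w, hw⟩ := hx
      refine le_trans ?_ (Finset.single_le_sum (fun w _ => gE_nonneg hc _ _ w) (Finset.mem_univ w))
      rw [gE_shift]
      refine Real.exp_le_exp.2 ?_
      nlinarith

lemma gordon_prob {η t δ : ℝ} (hη : 0 < η) (hδ : 0 < δ) (H : GordonData a b e h K) :
    (Measure.pi fun _ : ι => gaussianReal 0 1) {x | ∃ w, gRho η (fun i => a w i ⬝ᵥ x) + e ⬝ᵥ x ≤ t - δ} ≤
    (Measure.pi fun _ : ι => gaussianReal 0 1) {x | ∃ w, gRho η (fun i => b i ⬝ᵥ x) + h w ⬝ᵥ x < t + δ} := by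
  have mX : MeasurableSet {x : ι → ℝ | ∃ w, gRho η (fun i => a w i ⬝ᵥ x) + e ⬝ᵥ x ≤ t - δ} := by
    rw [Set.ofPred_exists]
    refine MeasurableSet.iUnion fun w => (IsClosed.measurableSet ?_)
    exact isClosed_le ((gRho_continuous _ fun i => dot_continuous _).add (dot_continuous _)) continuous_const
  have mY : MeasurableSet {x : ι → ℝ | ∃ w, gRho η (fun i => b i ⬝ᵥ x) + h w ⬝ᵥ x < t + δ} := by
    rw [Set.ofPred_exists]
    refine MeasurableSet.iUnion fun w => (IsOpen.measurableSet ?_)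
    exact isOpen_lt ((gRho_continuous _ fun i => dot_continuous _).add (dot_continuous _)) continuous_const
  have hBd : Filter.Tendsto (fun B : ℝ => B * δ) Filter.atTop Filter.atTop :=
    Filter.tendsto_id.atTop_mul_const hδ
  have t1 : Filter.Tendsto (fun B : ℝ => Real.exp (-((Fintype.card κ : ℝ) * Real.exp (-(B * δ)))) *
      (Measure.pi fun _ : ι => gaussianReal 0 1).real {x | ∃ w, gRho η (fun i => b i ⬝ᵥ x) + h w ⬝ᵥ x < t + δ}ᶜ)
      Filter.atTop (nhds (Real.exp (-((Fintype.card κ : ℝ) * 0)) * (Measure.pi fun _ : ι => gaussianReal 0 1).real {x | ∃ w, gRho η (fun i => b i ⬝ᵥ x) + h w ⬝ᵥ x < t + δ}ᶜ)) := by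
    refine Filter.Tendsto.mul_const _ ?_
    refine (Real.continuous_exp.tendsto _).comp (Filter.Tendsto.neg (Filter.Tendsto.const_mul _ ?_))
    exact Real.tendsto_exp_neg_atTop_nhds_zero.comp hBd
  have t2 : Filter.Tendsto (fun B : ℝ => (Measure.pi fun _ : ι => gaussianReal 0 1).real {x | ∃ w, gRho η (fun i => a w i ⬝ᵥ x) + e ⬝ᵥ x ≤ t - δ}ᶜ +
      Real.exp (-Real.exp (B * δ))) Filter.atTop (nhds ((Measure.pi fun _ : ι => gaussianReal 0 1).real {x | ∃ w, gRho η (fun i => a w i ⬝ᵥ x) + e ⬝ᵥ x ≤ t - δ}ᶜ + 0)) := by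
    refine Filter.Tendsto.const_add _ ?_
    exact Real.tendsto_exp_neg_atTop_nhds_zero.comp (Real.tendsto_exp_atTop.comp hBd)
  have := le_of_tendsto_of_tendsto t1 t2 (by
    filter_upwards [Filter.eventually_gt_atTop 0] with B hB
    exact gordon_prob_B hη hB H)
  rw [mul_zero, neg_zero, Real.exp_zero, one_mul, add_zero, probReal_compl_eq_one_sub mX,
    probReal_compl_eq_one_sub mY] at this
  rw [← ENNReal.toReal_le_toReal (measure_ne_top _ _) (measure_ne_top _ _)]
  simp only [Measure.real] at this
  linarith
end GordonProb

section Transport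

abbrev GI (m n : ℕ) := (Fin m × Fin n) ⊕ (Unit ⊕ (Fin m ⊕ Fin n))

lemma curry_mp (m n : ℕ) : MeasurePreserving (fun (x : Fin m × Fin n → ℝ) i j => x (i, j))
    (Measure.pi fun _ => gaussianReal 0 1) (matrixGaussian m n) := by
  refine ⟨by fun_prop, ?_⟩
  have := Measure.infinitePi_map_curry (ι := Fin m) (κ := Fin n) (fun _ _ => gaussianReal 0 1)
  simp only [Measure.infinitePi_eq_pi] at this
  exact this

lemma mp1 (m n : ℕ) : MeasurePreserving
    (fun x : GI m n → ℝ => ((fun i j => x (Sum.inl (i, j)) : Fin m → Fin n → ℝ), x (Sum.inr (Sum.inl ()))))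
    (Measure.pi fun _ => gaussianReal 0 1) ((matrixGaussian m n).prod (gaussianReal 0 1)) := by
  have h1 := measurePreserving_sumPiEquivProdPi (fun _ : GI m n => gaussianReal 0 1)
  have h2 := measurePreserving_eval (fun _ : Unit ⊕ (Fin m ⊕ Fin n) => gaussianReal 0 1) (Sum.inl ())
  haveI : SFinite (matrixGaussian m n) := by unfold matrixGaussian; infer_instance
  exact ((curry_mp m n).prod h2).comp h1

lemma mp2 (m n : ℕ) : MeasurePreserving
    (fun x : GI m n → ℝ => ((fun i => x (Sum.inr (Sum.inr (Sum.inl i))) : Fin m → ℝ),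
      (fun j => x (Sum.inr (Sum.inr (Sum.inr j))) : Fin n → ℝ)))
    (Measure.pi fun _ => gaussianReal 0 1)
    ((Measure.pi fun _ : Fin m => gaussianReal 0 1).prod (Measure.pi fun _ : Fin n => gaussianReal 0 1)) := by
  have h1 := measurePreserving_sumPiEquivProdPi (fun _ : GI m n => gaussianReal 0 1)
  have h2 := measurePreserving_sumPiEquivProdPi (fun _ : Unit ⊕ (Fin m ⊕ Fin n) => gaussianReal 0 1)
  have h3 := measurePreserving_sumPiEquivProdPi (fun _ : (Fin m ⊕ Fin n) => gaussianReal 0 1)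
  exact h3.comp (measurePreserving_snd.comp (h2.comp (measurePreserving_snd.comp h1)))

lemma half_gauss : 1 ≤ 2 * gaussianReal 0 1 (Set.Iic 0) := by
  have h : gaussianReal 0 1 (Set.Ici 0) = gaussianReal 0 1 (Set.Iic 0) := by
    have h1 := gaussianReal_map_neg (μ := 0) (v := 1)
    rw [neg_zero] at h1
    conv_lhs => rw [← h1]
    rw [Measure.map_apply measurable_neg measurableSet_Ici]
    congr 1; ext x; simp
  calc (1:ENNReal) = gaussianReal 0 1 Set.univ := by simp
    _ = gaussianReal 0 1 (Set.Iic 0 ∪ Set.Ici 0) := by rw [Set.Iic_union_Ici]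
    _ ≤ _ := measure_union_le _ _
    _ = _ := by rw [h, two_mul]

lemma escape_finite {m n : ℕ} {κ : Type*} [Fintype κ] (W : κ → Fin n → ℝ) (hW : ∀ k, ∑ j, W k j ^ 2 = 1)
    {δ : ℝ} (hδ : 0 < δ) :
    matrixGaussian m n {A | ∃ k, ∑ i, (∑ j, A i j * W k j) ^ 2 ≤ δ ^ 2} ≤
      2 * ((Measure.pi fun _ : Fin m => gaussianReal 0 1).prod (Measure.pi fun _ : Fin n => gaussianReal 0 1))
        {p | ∃ k, √(∑ i, p.1 i ^ 2) + ∑ j, W k j * p.2 j < 4 * δ} := by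
  have H : GordonData (ι := GI m n)
      (fun k (i : Fin m) => Sum.elim (fun q : Fin m × Fin n => if q.1 = i then W k q.2 else 0) (fun _ => 0))
      (fun i => Sum.elim (fun _ => 0) (Sum.elim (fun _ => 0) (Sum.elim (fun i' => if i' = i then 1 else 0) (fun _ => 0))))
      (Sum.elim (fun _ => 0) (Sum.elim (fun _ => 1) (fun _ => 0)))
      (fun k => Sum.elim (fun _ => 0) (Sum.elim (fun _ => 0) (Sum.elim (fun _ => 0) (W k))))
      (fun k k' => ∑ j, W k j * W k' j) := by
    constructor
    · intro w i w' i'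
      simp only [dotProduct, Fintype.sum_sum_type, Fintype.sum_prod_type, Sum.elim_inl, Sum.elim_inr]
      rw [Finset.sum_eq_single i (fun q _ hq => by simp [hq]) (by simp)]
      by_cases hi : i = i' <;> simp [hi]
    · intro i i'; simp [dotProduct, eq_comm]
    · intro w i i'; simp [dotProduct]
    · intro w i; simp [dotProduct]
    · intro w i w'; simp [dotProduct]
    · intro i; simp [dotProduct]
    · intro i w; simp [dotProduct]
    · simp [dotProduct]
    · intro w; simp [dotProduct]
    · intro w w'; simp [dotProduct]
    · intro w; rw [← hW w]; exact Finset.sum_congr rfl fun j _ => by ring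
    · intro w w'; exact Finset.sum_congr rfl fun j _ => by ring
    · intro w w'
      have : ∀ j ∈ Finset.univ, W w j * W w' j ≤ (W w j ^ 2 + W w' j ^ 2) / 2 := fun j _ => by
        nlinarith [sq_nonneg (W w j - W w' j)]
      refine (Finset.sum_le_sum this).trans ?_
      rw [← Finset.sum_div, Finset.sum_add_distrib, hW, hW]; norm_num
  have key := gordon_prob (η := δ ^ 2) (t := 3 * δ) (pow_pos hδ 2) hδ H
  have hA : MeasurableSet {A : Fin m → Fin n → ℝ | ∃ k, ∑ i, (∑ j, A i j * W k j) ^ 2 ≤ δ ^ 2} := by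
    rw [Set.ofPred_exists]
    refine MeasurableSet.iUnion fun w => (IsClosed.measurableSet ?_)
    exact isClosed_le (by fun_prop) continuous_const
  have hP : MeasurableSet {p : (Fin m → ℝ) × (Fin n → ℝ) | ∃ k, √(∑ i, p.1 i ^ 2) + ∑ j, W k j * p.2 j < 4 * δ} := by
    rw [Set.ofPred_exists]
    refine MeasurableSet.iUnion fun w => (IsOpen.measurableSet ?_)
    exact isOpen_lt (by fun_prop) continuous_const
  haveI : SFinite (matrixGaussian m n) := by unfold matrixGaussian; infer_instance
  have e1 := (mp1 m n).measure_preimage (hA.prod (measurableSet_Iic (a := (0:ℝ)))).nullMeasurableSet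
  have e2 := (mp2 m n).measure_preimage hP.nullMeasurableSet
  rw [Measure.prod_prod] at e1
  rw [← e2]
  calc _ ≤ matrixGaussian m n {A | ∃ k, ∑ i, (∑ j, A i j * W k j) ^ 2 ≤ δ ^ 2} * (2 * gaussianReal 0 1 (Set.Iic 0)) :=
        le_mul_of_one_le_right (by simp) half_gauss
    _ = 2 * (matrixGaussian m n {A | ∃ k, ∑ i, (∑ j, A i j * W k j) ^ 2 ≤ δ ^ 2} * gaussianReal 0 1 (Set.Iic 0)) := by ring
    _ ≤ _ := by
      rw [← e1]
      refine mul_le_mul_right ?_ 2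
      refine le_trans (measure_mono ?_) (key.trans (measure_mono ?_))
      · rintro x ⟨⟨k, hk⟩, hx0⟩
        refine ⟨k, ?_⟩
        simp only [Set.mem_Iic] at hx0 hk
        have h1 : gRho (δ ^ 2) (fun i => (Sum.elim (fun q : Fin m × Fin n => if q.1 = i then W k q.2 else 0) (fun _ => 0) : GI m n → ℝ) ⬝ᵥ x) ≤ 2 * δ := by
          refine Real.sqrt_le_iff.2 ⟨by positivity, ?_⟩
          have : ∀ i, (Sum.elim (fun q : Fin m × Fin n => if q.1 = i then W k q.2 else 0) (fun _ => 0) : GI m n → ℝ) ⬝ᵥ x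
              = ∑ j, x (Sum.inl (i, j)) * W k j := by
            intro i
            simp only [dotProduct, Fintype.sum_sum_type, Fintype.sum_prod_type, Sum.elim_inl, Sum.elim_inr]
            rw [Finset.sum_eq_single i (fun q _ hq => by simp [hq]) (by simp)]
            simp [mul_comm]
          simp only [this]
          nlinarith
        have h2 : (Sum.elim (fun _ => 0) (Sum.elim (fun _ => 1) (fun _ => 0)) : GI m n → ℝ) ⬝ᵥ x = x (Sum.inr (Sum.inl ())) := by
          simp [dotProduct]
        rw [h2]
        linarith
      · rintro x ⟨k, hk⟩
        refine ⟨k, ?_⟩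
        simp only [dotProduct, Fintype.sum_sum_type, Sum.elim_inl, Sum.elim_inr, zero_mul, Finset.sum_const_zero,
          zero_add, add_zero, ite_mul, one_mul, Finset.sum_ite_eq', Finset.mem_univ, if_true] at hk
        have h1 : √(∑ i, x (Sum.inr (Sum.inr (Sum.inl i))) ^ 2) ≤ gRho (δ ^ 2) (fun i => x (Sum.inr (Sum.inr (Sum.inl i)))) :=
          Real.sqrt_le_sqrt (by nlinarith)
        simp only
        linarith
end Transport


lemma escape_delta {m n : ℕ} (S : Set (Fin n → ℝ)) (hS : ∀ w ∈ S, ∑ j, w j ^ 2 = 1)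
    (T : (Fin n → ℝ) → ℝ) (hT : ∀ h, ∀ w ∈ S, -∑ j, w j * h j ≤ T h) {δ : ℝ} (hδ : 0 < δ) :
    matrixGaussian m n {A | ∃ w ∈ S, ∀ i, ∑ j, A i j * w j = 0} ≤
      2 * ((Measure.pi fun _ : Fin m => gaussianReal 0 1).prod (Measure.pi fun _ : Fin n => gaussianReal 0 1))
        {p | √(∑ i, p.1 i ^ 2) < 4 * δ + T p.2} := by
  rcases S.eq_empty_or_nonempty with rfl | hne
  · simp
  have : Nonempty S := hne.to_subtype
  let u : ℕ → S := TopologicalSpace.denseSeq S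
  have hu : DenseRange u := TopologicalSpace.denseRange_denseSeq S
  have hsub : {A : Fin m → Fin n → ℝ | ∃ w ∈ S, ∀ i, ∑ j, A i j * w j = 0} ⊆
      ⋃ N : ℕ, {A | ∃ k : Fin N, ∑ i, (∑ j, A i j * (u k : Fin n → ℝ) j) ^ 2 ≤ δ ^ 2} := by
    rintro A ⟨w, hw, hA⟩
    have ho : IsOpen {v : S | ∑ i, (∑ j, A i j * (v : Fin n → ℝ) j) ^ 2 < δ ^ 2} :=
      isOpen_lt (continuous_finset_sum _ fun i _ => (continuous_finset_sum _ fun j _ =>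
        continuous_const.mul ((continuous_apply j).comp continuous_subtype_val)).pow 2) continuous_const
    obtain ⟨k, hk⟩ := hu.exists_mem_open ho ⟨⟨w, hw⟩, by simp [hA]; positivity⟩
    exact Set.mem_iUnion.2 ⟨k + 1, ⟨k, Nat.lt_succ_self k⟩, le_of_lt hk⟩
  refine (measure_mono hsub).trans ?_
  rw [Monotone.measure_iUnion]
  · refine iSup_le fun N => ?_
    refine (escape_finite (fun k : Fin N => (u k : Fin n → ℝ)) (fun k => hS _ (u k).2) hδ).trans ?_
    refine mul_le_mul_right (measure_mono ?_) 2
    rintro p ⟨k, hk⟩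
    have := hT p.2 _ (u k).2
    simp only [Set.mem_ofPred_eq] at hk ⊢
    linarith
  · intro N M hNM A
    rintro ⟨k, hk⟩
    exact ⟨⟨k, k.2.trans_le hNM⟩, hk⟩

lemma escape_set {m n : ℕ} (S : Set (Fin n → ℝ)) (hS : ∀ w ∈ S, ∑ j, w j ^ 2 = 1)
    (T : (Fin n → ℝ) → ℝ) (mT : Measurable T) (hT0 : ∀ h, 0 ≤ T h) (hT : ∀ h, ∀ w ∈ S, -∑ j, w j * h j ≤ √(T h)) :
    matrixGaussian m n {A | ∃ w ∈ S, ∀ i, ∑ j, A i j * w j = 0} ≤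
      2 * ((Measure.pi fun _ : Fin m => gaussianReal 0 1).prod (Measure.pi fun _ : Fin n => gaussianReal 0 1))
        {p | ∑ i, p.1 i ^ 2 ≤ T p.2} := by
  set P := ((Measure.pi fun _ : Fin m => gaussianReal 0 1).prod (Measure.pi fun _ : Fin n => gaussianReal 0 1))
  have hlim := tendsto_measure_iInter_atTop (μ := P)
    (s := fun q : ℕ => {p : (Fin m → ℝ) × (Fin n → ℝ) | √(∑ i, p.1 i ^ 2) < 4 * (1 / ((q : ℝ) + 1)) + √(T p.2)})
    (fun q => (measurableSet_lt (by fun_prop) (by fun_prop)).nullMeasurableSet)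
    (by
      intro a b hab p hp
      simp only [Set.mem_ofPred_eq] at hp ⊢
      have : 1 / ((b : ℝ) + 1) ≤ 1 / ((a : ℝ) + 1) := Nat.one_div_le_one_div hab
      linarith)
    ⟨0, measure_ne_top _ _⟩
  have hle := ge_of_tendsto' hlim (b := matrixGaussian m n {A | ∃ w ∈ S, ∀ i, ∑ j, A i j * w j = 0} / 2) (fun q => by
    refine ENNReal.div_le_of_le_mul' ?_
    exact escape_delta S hS (fun h => √(T h)) hT (δ := 1 / ((q : ℝ) + 1)) (by positivity))
  have hint : (⋂ q : ℕ, {p : (Fin m → ℝ) × (Fin n → ℝ) | √(∑ i, p.1 i ^ 2) < 4 * (1 / ((q : ℝ) + 1)) + √(T p.2)}) ⊆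
      {p | ∑ i, p.1 i ^ 2 ≤ T p.2} := by
    intro p hp
    simp only [Set.mem_iInter, Set.mem_ofPred_eq] at hp ⊢
    rw [← Real.sqrt_le_sqrt_iff (hT0 _)]
    have ht : Filter.Tendsto (fun q : ℕ => 4 * (1 / ((q : ℝ) + 1)) + √(T p.2)) Filter.atTop (nhds (4 * 0 + √(T p.2))) :=
      (tendsto_one_div_add_atTop_nhds_zero_nat.const_mul 4).add_const _
    have := ge_of_tendsto' ht (fun q => (hp q).le)
    simpa using this
  have := hle.trans (measure_mono hint)
  rwa [ENNReal.div_le_iff_le_mul (by simp) (by simp), mul_comm] at this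


noncomputable def gf (ν t x : ℝ) : ℝ := (max (-x - ν) 0) ^ 2 + max ((max (x + ν) 0) ^ 2 - t) 0

lemma gf_nonneg (ν t x : ℝ) : 0 ≤ gf ν t x := by unfold gf; positivity

lemma det_bound {n k : ℕ} {ν t : ℝ} (hν : 0 ≤ ν) (ht : 0 ≤ t) (w h : Fin n → ℝ)
    (hw : ∑ j, w j ^ 2 = 1) (hs : ∑ j, w j ≤ 0) (K : Finset (Fin n)) (hK : K.card ≤ k)
    (hw0 : ∀ i ∉ K, 0 ≤ w i) :
    -∑ j, w j * h j ≤ √(k * t + ∑ j, gf ν t (h j)) := by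
  classical
  let u : Fin n → ℝ := fun i => if i ∈ K then -h i - ν else max (-h i - ν) 0
  have h1 : -∑ j, w j * h j ≤ ∑ j, w j * u j := by
    have e : -∑ j, w j * h j = ∑ j, w j * (-h j - ν) + ν * ∑ j, w j := by
      rw [Finset.mul_sum, ← Finset.sum_add_distrib, ← Finset.sum_neg_distrib]
      exact Finset.sum_congr rfl fun j _ => by ring
    have e2 : ∑ j, w j * (-h j - ν) ≤ ∑ j, w j * u j := by
      refine Finset.sum_le_sum fun j _ => ?_
      by_cases hj : j ∈ K
      · simp [u, hj]
      · simp only [u, hj, if_false]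
        exact mul_le_mul_of_nonneg_left (le_max_left _ _) (hw0 j hj)
    nlinarith
  have h2 : (∑ j, w j * u j) ^ 2 ≤ ∑ j, u j ^ 2 := by
    have := Finset.sum_mul_sq_le_sq_mul_sq Finset.univ w u
    rwa [hw, one_mul] at this
  have h3 : ∑ j, u j ^ 2 ≤ k * t + ∑ j, gf ν t (h j) := by
    have : ∑ j, u j ^ 2 ≤ ∑ j, ((if j ∈ K then t else 0) + gf ν t (h j)) := by
      refine Finset.sum_le_sum fun j _ => ?_
      have m1 := le_max_left ((max (h j + ν) 0) ^ 2 - t) 0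
      have m0 := le_max_right ((max (h j + ν) 0) ^ 2 - t) 0
      by_cases hj : j ∈ K
      · simp only [u, hj, if_true, gf]
        rcases le_total (h j + ν) 0 with hc | hc
        · rw [max_eq_left (by linarith : (0:ℝ) ≤ -h j - ν)]; linarith
        · rw [max_eq_right (by linarith : -h j - ν ≤ (0:ℝ))]
          rw [max_eq_left hc] at m1 m0 ⊢
          nlinarith
      · simp only [u, hj, if_false, gf]; linarith
    refine this.trans ?_
    rw [Finset.sum_add_distrib]
    gcongr
    simp only [Finset.sum_ite_mem, Finset.univ_inter, Finset.sum_const, nsmul_eq_mul]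
    gcongr
  exact h1.trans (Real.le_sqrt_of_sq_le (h2.trans h3))


lemma gf_continuous (ν t : ℝ) : Continuous (gf ν t) := by unfold gf; fun_prop

lemma bad_bound {m n k : ℕ} {ν t : ℝ} (hν : 0 ≤ ν) (ht : 0 ≤ t) :
    matrixGaussian m n {A | ∀ x : Fin n → ℝ, (∀ i, 0 ≤ x i) →
            (∃ K : Finset (Fin n), K.card ≤ k ∧ ∀ i ∉ K, x i = 0) →
              UniqueL1MinNonneg A x}ᶜ ≤
      2 * ((Measure.pi fun _ : Fin m => gaussianReal 0 1).prod (Measure.pi fun _ : Fin n => gaussianReal 0 1))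
        {p | ∑ i, p.1 i ^ 2 ≤ k * t + ∑ j, gf ν t (p.2 j)} := by
  have mT : Measurable (fun h : Fin n → ℝ => k * t + ∑ j, gf ν t (h j)) := by
    refine Measurable.const_add (Finset.measurable_sum _ fun j _ => ?_) _
    exact (gf_continuous ν t).measurable.comp (measurable_pi_apply j)
  refine le_trans (measure_mono ?_) (escape_set
    {w : Fin n → ℝ | ∑ j, w j ^ 2 = 1 ∧ ∑ j, w j ≤ 0 ∧ ∃ K : Finset (Fin n), K.card ≤ k ∧ ∀ i ∉ K, 0 ≤ w i}
    (fun w hw => hw.1) _ mT (fun h => ?_) ?_)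
  · intro A hA
    simp only [Set.mem_compl_iff, Set.mem_ofPred_eq, UniqueL1MinNonneg, not_forall, not_lt] at hA
    obtain ⟨x, hx, ⟨K, hK, hxK⟩, z, hz, hz0, hne, hle⟩ := hA
    have hpos : 0 < ∑ j, (z j - x j) ^ 2 := by
      obtain ⟨j, hj⟩ := Function.ne_iff.1 hne
      refine Finset.sum_pos' (fun _ _ => sq_nonneg _) ⟨j, Finset.mem_univ j, ?_⟩
      have : z j - x j ≠ 0 := sub_ne_zero.2 hj
      positivity
    set r := √(∑ j, (z j - x j) ^ 2) with hr
    have hr0 : 0 < r := Real.sqrt_pos.2 hpos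
    have hr2 : r ^ 2 = ∑ j, (z j - x j) ^ 2 := Real.sq_sqrt hpos.le
    refine ⟨fun j => (z j - x j) / r, ⟨?_, ?_, K, hK, ?_⟩, ?_⟩
    · simp only [div_pow]
      rw [← Finset.sum_div, ← hr2, div_self (by positivity)]
    · rw [← Finset.sum_div]
      refine div_nonpos_of_nonpos_of_nonneg ?_ hr0.le
      simp only [abs_of_nonneg (hx _), abs_of_nonneg (hz0 _)] at hle
      rw [Finset.sum_sub_distrib]; linarith
    · intro i hi
      simp only [hxK i hi, sub_zero]
      exact div_nonneg (hz0 i) hr0.le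
    · intro i
      have : ∑ j, A i j * ((z j - x j) / r) = (∑ j, A i j * z j - ∑ j, A i j * x j) / r := by
        rw [← Finset.sum_sub_distrib, Finset.sum_div]
        exact Finset.sum_congr rfl fun j _ => by ring
      rw [this, hz i, sub_self, zero_div]
  · have : 0 ≤ ∑ j, gf ν t (h j) := Finset.sum_nonneg fun j _ => gf_nonneg _ _ _
    positivity
  · rintro h w ⟨h1, h2, K, hK, h3⟩
    exact det_bound hν ht w h h1 h2 K hK h3


lemma integrable_exp_sq {s : ℝ} (hs : s < 1 / 2) : Integrable (fun x => Real.exp (s * x ^ 2)) (gaussianReal 0 1) := by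
  rw [gaussianReal_of_var_ne_zero 0 one_ne_zero, gaussianPDF_def,
    integrable_withDensity_iff_integrable_smul' (by fun_prop) (by simp)]
  have := (integrable_exp_neg_mul_sq (b := 1 / 2 - s) (by linarith)).const_mul (√(2 * Real.pi * (1:NNReal)))⁻¹
  refine this.congr (ae_of_all _ fun x => ?_)
  simp only [smul_eq_mul]
  rw [ENNReal.toReal_ofReal (gaussianPDFReal_nonneg 0 1 x), gaussianPDFReal, mul_assoc _ _ (Real.exp (s * x ^ 2)), ← Real.exp_add]
  congr 2
  push_cast; ring

lemma chernoff {m n : ℕ} {f : ℝ → ℝ} (mf : Measurable f) {s C : ℝ} (hs : 0 ≤ s)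
    (hf : Integrable (fun x => Real.exp (s * f x)) (gaussianReal 0 1)) :
    ((Measure.pi fun _ : Fin m => gaussianReal 0 1).prod (Measure.pi fun _ : Fin n => gaussianReal 0 1))
        {p | ∑ i, p.1 i ^ 2 ≤ C + ∑ j, f (p.2 j)} ≤
      ENNReal.ofReal (Real.exp (s * C) * mgf (fun x => -x ^ 2) (gaussianReal 0 1) s ^ m * mgf f (gaussianReal 0 1) s ^ n) := by
  set P := ((Measure.pi fun _ : Fin m => gaussianReal 0 1).prod (Measure.pi fun _ : Fin n => gaussianReal 0 1))
  have hq : Integrable (fun x : ℝ => Real.exp (s * -x ^ 2)) (gaussianReal 0 1) := by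
    have := integrable_exp_sq (s := -s) (by linarith)
    simpa using this
  have e : (fun p : (Fin m → ℝ) × (Fin n → ℝ) => Real.exp (s * (∑ j, f (p.2 j) - ∑ i, p.1 i ^ 2))) =
      fun p => (∏ i, Real.exp (s * -(p.1 i) ^ 2)) * ∏ j, Real.exp (s * f (p.2 j)) := by
    ext p
    rw [← Real.exp_sum, ← Real.exp_sum, ← Real.exp_add, ← Finset.mul_sum, ← Finset.mul_sum, Finset.sum_neg_distrib]
    congr 1; ring
  have i1 : Integrable (fun g : Fin m → ℝ => ∏ i, Real.exp (s * -(g i) ^ 2)) (Measure.pi fun _ => gaussianReal 0 1) :=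
    Integrable.fintype_prod (fun _ => hq)
  have i2 : Integrable (fun g : Fin n → ℝ => ∏ i, Real.exp (s * f (g i))) (Measure.pi fun _ => gaussianReal 0 1) :=
    Integrable.fintype_prod (fun _ => hf)
  have hi : Integrable (fun p : (Fin m → ℝ) × (Fin n → ℝ) => Real.exp (s * (∑ j, f (p.2 j) - ∑ i, p.1 i ^ 2))) P := by
    rw [e]; exact i1.mul_prod i2
  have hm : mgf (fun p : (Fin m → ℝ) × (Fin n → ℝ) => ∑ j, f (p.2 j) - ∑ i, p.1 i ^ 2) P s =
      mgf (fun x => -x ^ 2) (gaussianReal 0 1) s ^ m * mgf f (gaussianReal 0 1) s ^ n := by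
    unfold mgf
    rw [e, integral_prod_mul (fun g : Fin m → ℝ => ∏ i, Real.exp (s * -(g i) ^ 2)) (fun g : Fin n → ℝ => ∏ i, Real.exp (s * f (g i))),
      integral_fintype_prod_eq_prod (fun _ x => Real.exp (s * -x ^ 2)),
      integral_fintype_prod_eq_prod (fun _ x => Real.exp (s * f x))]
    simp
  have key := measure_ge_le_exp_mul_mgf (-C) hs hi
  rw [hm] at key
  rw [← ENNReal.ofReal_toReal (measure_ne_top P _)]
  refine ENNReal.ofReal_le_ofReal ?_
  refine le_trans (le_of_eq ?_) (key.trans (le_of_eq ?_))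
  · unfold Measure.real
    congr 2; ext p; simp only [Set.mem_ofPred_eq]; constructor <;> intro h <;> linarith
  · rw [mul_assoc]; congr 2; ring

open Filter Topology

lemma pdf_eq (x : ℝ) : gaussianPDFReal 0 1 x = Real.exp (-x ^ 2 / 2) / √(2 * Real.pi) := by
  rw [gaussianPDFReal]; simp; ring

lemma hasDerivAt_erf (x : ℝ) : HasDerivAt erf (2 / √Real.pi * Real.exp (-x ^ 2)) x := by
  unfold erf
  refine HasDerivAt.const_mul _ ?_
  have c : Continuous (fun t : ℝ => Real.exp (-t ^ 2)) := by fun_prop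
  exact intervalIntegral.integral_hasDerivAt_right (c.intervalIntegrable _ _) (c.stronglyMeasurableAtFilter _ _) c.continuousAt

lemma erf_tendsto : Tendsto erf atTop (𝓝 1) := by
  have hi := integrable_exp_neg_mul_sq (b := 1) one_pos
  have h := (intervalIntegral_tendsto_integral_Ioi 0 hi.integrableOn tendsto_id).const_mul (2 / √Real.pi)
  rw [integral_gaussian_Ioi] at h
  have hp : √Real.pi ≠ 0 := by positivity
  have e : 2 / √Real.pi * (√(Real.pi / 1) / 2) = 1 := by rw [div_one]; field_simp
  rw [e] at h
  refine h.congr fun x => ?_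
  simp [erf]

lemma erf_neg (x : ℝ) : erf (-x) = -erf x := by
  unfold erf
  have := intervalIntegral.integral_comp_neg (a := 0) (b := x) (fun t : ℝ => Real.exp (-t ^ 2))
  simp only [neg_sq, neg_zero] at this
  rw [this, intervalIntegral.integral_symm]; ring

lemma erf_erfinv {y : ℝ} (h1 : -1 < y) (h2 : y < 1) : erf (erfinv y) = y := by
  refine Function.invFun_eq ?_
  have hc : Continuous erf := continuous_iff_continuousAt.2 fun x => (hasDerivAt_erf x).continuousAt
  obtain ⟨b, hb⟩ := (erf_tendsto.eventually (lt_mem_nhds h2)).exists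
  obtain ⟨a, ha⟩ := (erf_tendsto.eventually (lt_mem_nhds (show -y < 1 by linarith))).exists
  exact mem_range_of_exists_le_of_exists_ge hc ⟨-a, by rw [erf_neg]; linarith⟩ ⟨b, hb.le⟩

lemma hasDerivAt_erf_half (x : ℝ) : HasDerivAt (fun x => 1 / 2 * erf (x / √2)) (gaussianPDFReal 0 1 x) x := by
  have h := ((hasDerivAt_erf (x / √2)).comp x ((hasDerivAt_id x).div_const (√2))).const_mul (1 / 2)
  refine h.congr_deriv ?_
  rw [pdf_eq, div_pow, Real.sq_sqrt (by norm_num), Real.sqrt_mul (by norm_num)]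
  have : √Real.pi ≠ 0 := by positivity
  have : √2 ≠ 0 := by positivity
  field_simp

lemma erf_half_tendsto : Tendsto (fun x => 1 / 2 * erf (x / √2)) atTop (𝓝 (1 / 2)) := by
  have := (erf_tendsto.comp (tendsto_id.atTop_div_const (show 0 < √2 by positivity))).const_mul (1 / 2)
  simpa using this

lemma lin_pdf_tendsto (d : ℝ) : Tendsto (fun x => (2 * d + x) * gaussianPDFReal 0 1 x) atTop (𝓝 0) := by
  have h0 : Tendsto (fun x : ℝ => Real.exp (-x)) atTop (𝓝 0) := Real.tendsto_exp_neg_atTop_nhds_zero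
  have h1 : Tendsto (fun x : ℝ => x * Real.exp (-x)) atTop (𝓝 0) := by
    simpa using Real.tendsto_pow_mul_exp_neg_atTop_nhds_zero 1
  have h2 : Tendsto (fun x : ℝ => (2 * |d| * Real.exp (-x) + x * Real.exp (-x)) * (Real.exp (1 / 2) / √(2 * Real.pi))) atTop (𝓝 0) := by
    have := ((h0.const_mul (2 * |d|)).add h1).mul_const (Real.exp (1 / 2) / √(2 * Real.pi))
    simpa using this
  refine squeeze_zero_norm' ?_ h2
  filter_upwards [eventually_ge_atTop 0] with x hx
  have e : Real.exp (-x ^ 2 / 2) ≤ Real.exp (-x) * Real.exp (1 / 2) := by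
    rw [← Real.exp_add]; refine Real.exp_le_exp.2 ?_; nlinarith [sq_nonneg (x - 1)]
  have e2 : |2 * d + x| ≤ 2 * |d| + x := by
    refine (abs_add_le _ _).trans ?_
    rw [abs_mul, abs_of_nonneg hx]; simp
  rw [Real.norm_eq_abs, abs_mul, pdf_eq, abs_of_pos (by positivity : 0 < Real.exp (-x ^ 2 / 2) / √(2 * Real.pi))]
  calc |2 * d + x| * (Real.exp (-x ^ 2 / 2) / √(2 * Real.pi))
      ≤ (2 * |d| + x) * ((Real.exp (-x) * Real.exp (1 / 2)) / √(2 * Real.pi)) := by gcongr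
    _ = _ := by ring

lemma hasDerivAt_G (d x : ℝ) : HasDerivAt (fun x => (1 + d ^ 2) * (1 / 2 * erf (x / √2)) - (2 * d + x) * gaussianPDFReal 0 1 x)
    ((x + d) ^ 2 * gaussianPDFReal 0 1 x) x := by
  have h := ((hasDerivAt_erf_half x).const_mul (1 + d ^ 2)).sub (((hasDerivAt_id x).const_add (2 * d)).mul (hasDerivAt_pdf x))
  refine h.congr_deriv ?_
  simp only [id]; ring

lemma G_tendsto (d : ℝ) : Tendsto (fun x => (1 + d ^ 2) * (1 / 2 * erf (x / √2)) - (2 * d + x) * gaussianPDFReal 0 1 x) atTop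
    (𝓝 ((1 + d ^ 2) * (1 / 2) - 0)) := (erf_half_tendsto.const_mul _).sub (lin_pdf_tendsto d)

lemma tail_sq (a d : ℝ) : ∫ x in Set.Ioi a, (x + d) ^ 2 * gaussianPDFReal 0 1 x =
    (1 + d ^ 2) * (1 / 2 * erfc (a / √2)) + (2 * d + a) * gaussianPDFReal 0 1 a := by
  rw [integral_Ioi_of_hasDerivAt_of_nonneg' (fun x _ => hasDerivAt_G d x)
    (fun x _ => mul_nonneg (sq_nonneg _) (gaussianPDFReal_nonneg _ _ _)) (G_tendsto d)]
  unfold erfc; ring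

lemma tail_sq_int (a d : ℝ) : IntegrableOn (fun x => (x + d) ^ 2 * gaussianPDFReal 0 1 x) (Set.Ioi a) :=
  integrableOn_Ioi_deriv_of_nonneg' (fun x _ => hasDerivAt_G d x)
    (fun x _ => mul_nonneg (sq_nonneg _) (gaussianPDFReal_nonneg _ _ _)) (G_tendsto d)

lemma tail_one (a : ℝ) : ∫ x in Set.Ioi a, gaussianPDFReal 0 1 x = 1 / 2 * erfc (a / √2) := by
  rw [integral_Ioi_of_hasDerivAt_of_nonneg' (fun x _ => hasDerivAt_erf_half x)
    (fun x _ => (gaussianPDFReal_nonneg _ _ _)) erf_half_tendsto]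
  unfold erfc; ring


lemma tail_gauss (F : ℝ → ℝ) (a : ℝ) : ∫ x, (Set.Ioi a).indicator F x ∂(gaussianReal 0 1) =
    ∫ x in Set.Ioi a, F x * gaussianPDFReal 0 1 x := by
  rw [integral_gaussianReal_eq_integral_smul one_ne_zero, ← integral_indicator measurableSet_Ioi]
  congr 1; ext x
  by_cases hx : x ∈ Set.Ioi a
  · simp only [Set.indicator_of_mem hx, smul_eq_mul]; ring
  · simp only [Set.indicator_of_notMem hx, smul_zero]

lemma integrable_sq_gauss (d : ℝ) : Integrable (fun x : ℝ => (x + d) ^ 2) (gaussianReal 0 1) := by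
  have h := (memLp_id_gaussianReal (μ := 0) (v := 1) 2).add (memLp_const d)
  exact h.integrable_sq

lemma gf_le {ν t : ℝ} (ht : 0 ≤ t) (x : ℝ) : gf ν t x ≤ (x + ν) ^ 2 := by
  unfold gf
  rcases le_total (x + ν) 0 with hc | hc
  · rw [max_eq_left (by linarith : (0:ℝ) ≤ -x - ν), max_eq_right hc, max_eq_right (by linarith)]; nlinarith
  · rw [max_eq_right (by linarith : -x - ν ≤ (0:ℝ)), max_eq_left hc]
    have : max ((x + ν) ^ 2 - t) 0 ≤ (x + ν) ^ 2 := max_le (by linarith) (by positivity)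
    linarith

lemma integral_gf_le {ν : ℝ} (c : ℝ) :
    ∫ x, gf ν ((max (c + ν) 0) ^ 2) x ∂(gaussianReal 0 1) ≤
     ((1 + ν ^ 2) * (1 / 2 * erfc (ν / √2)) + (2 * (-ν) + ν) * gaussianPDFReal 0 1 ν) +
     (((1 + ν ^ 2) * (1 / 2 * erfc (c / √2)) + (2 * ν + c) * gaussianPDFReal 0 1 c) -
       (max (c + ν) 0) ^ 2 * (1 / 2 * erfc (c / √2))) := by
  set t := (max (c + ν) 0) ^ 2 with ht
  have ht0 : 0 ≤ t := by positivity
  have dom : ∀ (u : ℝ → ℝ), Continuous u → (∀ x, 0 ≤ u x) → (∀ x, u x ≤ (x + ν) ^ 2) → Integrable u (gaussianReal 0 1) := by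
    intro u hu h0 h1
    refine (integrable_sq_gauss ν).mono' hu.aestronglyMeasurable (ae_of_all _ fun x => ?_)
    rw [Real.norm_eq_abs, abs_of_nonneg (h0 x)]; exact h1 x
  have i1 : Integrable (fun x : ℝ => (max (-x - ν) 0) ^ 2) (gaussianReal 0 1) := by
    refine dom _ (by fun_prop) (fun x => by positivity) fun x => ?_
    have := gf_le (ν := ν) ht0 x
    unfold gf at this
    linarith [le_max_right ((max (x + ν) 0) ^ 2 - t) 0]
  have i2 : Integrable (fun x : ℝ => max ((max (x + ν) 0) ^ 2 - t) 0) (gaussianReal 0 1) := by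
    refine dom _ (by fun_prop) (fun x => by positivity) fun x => ?_
    have := gf_le (ν := ν) ht0 x
    unfold gf at this
    linarith [sq_nonneg (max (-x - ν) 0)]
  have e0 : ∫ x, gf ν t x ∂(gaussianReal 0 1) = ∫ x, (max (-x - ν) 0) ^ 2 ∂(gaussianReal 0 1) +
      ∫ x, max ((max (x + ν) 0) ^ 2 - t) 0 ∂(gaussianReal 0 1) := by
    rw [← integral_add i1 i2]; rfl
  rw [e0]
  refine add_le_add (le_of_eq ?_) ?_
  · have h1 := gaussianReal_map_neg (μ := 0) (v := 1)
    rw [neg_zero] at h1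
    have h2 : ∫ x, (max (-x - ν) 0) ^ 2 ∂(gaussianReal 0 1) = ∫ x, (max (x - ν) 0) ^ 2 ∂(gaussianReal 0 1) := by
      conv_rhs => rw [← h1]
      rw [integral_map measurable_neg.aemeasurable (by fun_prop)]
    have h3 : (fun x : ℝ => (max (x - ν) 0) ^ 2) = (Set.Ioi ν).indicator (fun x => (x + -ν) ^ 2) := by
      ext x
      by_cases hx : x ∈ Set.Ioi ν
      · rw [Set.indicator_of_mem hx, max_eq_left (by linarith [Set.mem_Ioi.1 hx])]; ring
      · rw [Set.indicator_of_notMem hx, max_eq_right (by linarith [not_lt.1 (fun h => hx (Set.mem_Ioi.2 h))])]; ring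
    rw [h2, h3, tail_gauss, tail_sq]; ring
  · have j1 : Integrable ((Set.Ioi c).indicator (fun x => (x + ν) ^ 2)) (gaussianReal 0 1) :=
      (integrable_sq_gauss ν).indicator measurableSet_Ioi
    have j2 : Integrable ((Set.Ioi c).indicator (fun _ => (1:ℝ))) (gaussianReal 0 1) :=
      (integrable_const _).indicator measurableSet_Ioi
    have h1 : ∫ x, (Set.Ioi c).indicator (fun _ => (1:ℝ)) x ∂(gaussianReal 0 1) = 1 / 2 * erfc (c / √2) := by
      rw [tail_gauss]; simp only [one_mul]; exact tail_one c
    rw [← tail_sq c ν, ← tail_gauss, ← h1, ← integral_const_mul, ← integral_sub j1 (j2.const_mul _)]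
    refine integral_mono i2 (j1.sub (j2.const_mul _)) fun x => ?_
    by_cases hx : x ∈ Set.Ioi c
    · simp only [Set.indicator_of_mem hx, mul_one]
      have hx' : c < x := hx
      have hm : max (c + ν) 0 ≤ max (x + ν) 0 := max_le_max (by linarith) le_rfl
      have h2 : t ≤ (max (x + ν) 0) ^ 2 := by rw [ht]; gcongr
      have h3 : (max (x + ν) 0) ^ 2 ≤ (x + ν) ^ 2 := by
        rcases le_total (x + ν) 0 with h | h
        · rw [max_eq_right h]; nlinarith
        · rw [max_eq_left h]
      exact max_le (by linarith) (by linarith)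
    · simp only [Set.indicator_of_notMem hx, mul_zero, sub_zero]
      have hx' : x ≤ c := not_lt.1 hx
      have hm : max (x + ν) 0 ≤ max (c + ν) 0 := max_le_max (by linarith) le_rfl
      have h2 : (max (x + ν) 0) ^ 2 ≤ t := by rw [ht]; gcongr
      exact max_le (by linarith) le_rfl

lemma expr_bound {β ν : ℝ} (hβ : β ∈ Set.Ioo (0 : ℝ) 1) :
    ∃ t : ℝ, 0 ≤ t ∧ β * t + ∫ x, gf ν t x ∂(gaussianReal 0 1) ≤
      ((1 / 2) * erfc (ν / Real.sqrt 2) +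
              (ν / Real.sqrt (2 * Real.pi)) * Real.exp (-ν ^ 2 / 2))
          + (β + (1 / Real.sqrt Real.pi) * erfinv (2 * (1 - β) - 1) *
              Real.exp (-(erfinv (2 * (1 - β) - 1)) ^ 2))
          + (((1 / 2) * erfc (ν / Real.sqrt 2) + β) * ν ^ 2 +
              ν * Real.sqrt (2 / Real.pi) *
                (Real.exp (-(erfinv (2 * (1 - β) - 1)) ^ 2) - Real.exp (-ν ^ 2 / 2))) := by
  set y := erfinv (2 * (1 - β) - 1) with hy
  have hey : erf y = 2 * (1 - β) - 1 := erf_erfinv (by linarith [hβ.2]) (by linarith [hβ.1])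
  have h2 : √2 ≠ 0 := by positivity
  have hp : √Real.pi ≠ 0 := by positivity
  have h22 : √2 * √2 = 2 := Real.mul_self_sqrt (by norm_num)
  have hQ : 1 / 2 * erfc ((√2 * y) / √2) = β := by
    rw [mul_div_cancel_left₀ _ h2, erfc, hey]; ring
  have hb := integral_gf_le (ν := ν) (√2 * y)
  rw [hQ, pdf_eq, pdf_eq] at hb
  refine ⟨_, sq_nonneg (max (√2 * y + ν) 0), ?_⟩
  have e1 : -(√2 * y) ^ 2 / 2 = -y ^ 2 := by rw [mul_pow, Real.sq_sqrt (by norm_num)]; ring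
  rw [e1] at hb
  have e2 : √(2 / Real.pi) = 2 / √(2 * Real.pi) := by
    rw [Real.sqrt_div (by norm_num), Real.sqrt_mul (by norm_num)]; field_simp; linarith
  have e3 : √2 * y / √(2 * Real.pi) = 1 / √Real.pi * y := by
    rw [Real.sqrt_mul (by norm_num)]; field_simp
  rw [e2]
  have e4 : (2 * ν + √2 * y) * (Real.exp (-y ^ 2) / √(2 * Real.pi)) =
    ν * (2 / √(2 * Real.pi)) * Real.exp (-y ^ 2) + 1 / √Real.pi * y * Real.exp (-y ^ 2) := by
    rw [← e3]; ring
  rw [e4] at hb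
  have e5 : (2 * -ν + ν) * (Real.exp (-ν ^ 2 / 2) / √(2 * Real.pi)) =
    ν / √(2 * Real.pi) * Real.exp (-ν ^ 2 / 2) - ν * (2 / √(2 * Real.pi)) * Real.exp (-ν ^ 2 / 2) := by ring
  rw [e5] at hb
  linarith


lemma ies_sq : (0:ℝ) ∈ interior (integrableExpSet (fun x : ℝ => -x ^ 2) (gaussianReal 0 1)) := by
  rw [mem_interior]
  refine ⟨Set.Ioo (-(1/2)) 1, fun s hs => ?_, isOpen_Ioo, by norm_num⟩
  have := integrable_exp_sq (s := -s) (by linarith [hs.1])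
  refine this.congr (ae_of_all _ fun x => ?_)
  simp

lemma ies_gf {ν t : ℝ} (ht : 0 ≤ t) : ∀ s ∈ Set.Ioo (-(1/4) : ℝ) (1/4), Integrable (fun x => Real.exp (s * gf ν t x)) (gaussianReal 0 1) := by
  intro s hs
  have h := (integrable_exp_sq (s := 2 * |s|) (by have := abs_lt.2 hs; linarith)).const_mul (Real.exp (2 * |s| * ν ^ 2))
  refine h.mono' (by have := gf_continuous ν t; fun_prop) (ae_of_all _ fun x => ?_)
  rw [Real.norm_eq_abs, Real.abs_exp, ← Real.exp_add]
  refine Real.exp_le_exp.2 ?_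
  have h1 : s * gf ν t x ≤ |s| * (x + ν) ^ 2 :=
    mul_le_mul (le_abs_self s) (gf_le ht x) (gf_nonneg _ _ _) (abs_nonneg s)
  have h2 : |s| * (x + ν) ^ 2 ≤ |s| * (2 * x ^ 2 + 2 * ν ^ 2) :=
    mul_le_mul_of_nonneg_left (by nlinarith [sq_nonneg (x - ν)]) (abs_nonneg s)
  linarith

lemma ies_gf' {ν t : ℝ} (ht : 0 ≤ t) : (0:ℝ) ∈ interior (integrableExpSet (gf ν t) (gaussianReal 0 1)) := by
  rw [mem_interior]
  exact ⟨Set.Ioo (-(1/4)) (1/4), fun s hs => ies_gf ht s hs, isOpen_Ioo, by norm_num⟩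

lemma integral_neg_sq : ∫ x, -x ^ 2 ∂(gaussianReal 0 1) = -1 := by
  rw [integral_neg]
  have h := variance_of_integral_eq_zero (μ := gaussianReal 0 1) (X := fun x => x) (by fun_prop) (by simp)
  rw [← h, variance_fun_id_gaussianReal]; simp

lemma exists_s {α β ν t : ℝ} (ht : 0 ≤ t) (h : β * t + ∫ x, gf ν t x ∂(gaussianReal 0 1) < α) :
    ∃ s : ℝ, 0 < s ∧ s < 1 / 4 ∧ α * cgf (fun x => -x ^ 2) (gaussianReal 0 1) s + cgf (gf ν t) (gaussianReal 0 1) s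
      + s * (β * t) < 0 := by
  have d1 : HasDerivAt (cgf (fun x : ℝ => -x ^ 2) (gaussianReal 0 1)) (-1) 0 := by
    have := (analyticAt_cgf ies_sq).differentiableAt.hasDerivAt
    rw [deriv_cgf_zero ies_sq, integral_neg_sq] at this
    simpa using this
  have d2 : HasDerivAt (cgf (gf ν t) (gaussianReal 0 1)) (∫ x, gf ν t x ∂(gaussianReal 0 1)) 0 := by
    have := (analyticAt_cgf (ies_gf' (ν := ν) ht)).differentiableAt.hasDerivAt
    rw [deriv_cgf_zero (ies_gf' ht)] at this
    simpa using this
  have d := ((d1.const_mul α).add d2).add ((hasDerivAt_id (0:ℝ)).mul_const (β * t))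
  have hneg : α * -1 + ∫ x, gf ν t x ∂(gaussianReal 0 1) + 1 * (β * t) < 0 := by linarith
  have hs := d.hasDerivWithinAt (s := Set.Ioi 0)
  have ht2 := (hasDerivWithinAt_iff_tendsto_slope' (by simp)).1 hs
  have hev := ht2.eventually (gt_mem_nhds hneg)
  have hev2 : ∀ᶠ s in 𝓝[>] (0:ℝ), s ∈ Set.Ioo (0:ℝ) (1/4) := Ioo_mem_nhdsGT (by norm_num)
  obtain ⟨s, h1, h2⟩ := (hev.and hev2).exists
  refine ⟨s, h2.1, h2.2, ?_⟩
  rw [slope_def_field, div_lt_iff₀ (by linarith [h2.1])] at h1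
  simpa using h1

lemma final_bound {α β ν t s : ℝ} (hβ : 0 < β) (ht : 0 ≤ t) (hs0 : 0 < s) (hs1 : s < 1 / 4) (n : ℕ) (hν : 0 ≤ ν) :
    matrixGaussian (⌈α * n⌉₊) n
          {A | ∀ x : Fin n → ℝ, (∀ i, 0 ≤ x i) →
            (∃ K : Finset (Fin n), K.card ≤ ⌈β * n⌉₊ ∧ ∀ i ∉ K, x i = 0) →
              UniqueL1MinNonneg A x}ᶜ ≤
      ENNReal.ofReal (2 * Real.exp (s * t + n * (α * cgf (fun x => -x ^ 2) (gaussianReal 0 1) s +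
        cgf (gf ν t) (gaussianReal 0 1) s + s * (β * t)))) := by
  have hf := ies_gf (ν := ν) ht s ⟨by linarith, hs1⟩
  have hq : Integrable (fun x : ℝ => Real.exp (s * -x ^ 2)) (gaussianReal 0 1) := by
    have := integrable_exp_sq (s := -s) (by linarith)
    simpa using this
  refine (bad_bound (ν := ν) hν ht).trans ?_
  rw [ENNReal.ofReal_mul (by norm_num), ENNReal.ofReal_ofNat]
  refine mul_le_mul_right ((chernoff (gf_continuous ν t).measurable hs0.le hf).trans (ENNReal.ofReal_le_ofReal ?_)) 2
  rw [← exp_cgf hf, ← exp_cgf hq, ← Real.exp_nat_mul, ← Real.exp_nat_mul, ← Real.exp_add, ← Real.exp_add]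
  refine Real.exp_le_exp.2 ?_
  have hL : cgf (fun x => -x ^ 2) (gaussianReal 0 1) s ≤ 0 := by
    refine Real.log_nonpos mgf_nonneg ?_
    have : mgf (fun x => -x ^ 2) (gaussianReal 0 1) s ≤ ∫ x, (1:ℝ) ∂(gaussianReal 0 1) := by
      refine integral_mono hq (integrable_const _) fun x => ?_
      refine Real.exp_le_one_iff.2 ?_
      nlinarith [sq_nonneg x]
    simpa using this
  have h1 : α * n ≤ (⌈α * n⌉₊ : ℝ) := Nat.le_ceil _
  have h2 : (⌈β * n⌉₊ : ℝ) ≤ β * n + 1 := (Nat.ceil_lt_add_one (by positivity)).le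
  have h3 := mul_le_mul_of_nonpos_right h1 hL
  have h4 := mul_le_mul_of_nonneg_right h2 (mul_nonneg hs0.le ht)
  linarith

theorem strong_threshold_nonnegative_lower_bound
    (α β : ℝ) (hα : α ∈ Set.Ioo (0 : ℝ) 1) (hβ : β ∈ Set.Ioo (0 : ℝ) 1)
    (hcond : sInf {v : ℝ | ∃ ν : ℝ, 0 ≤ ν ∧
        v = ((1 / 2) * erfc (ν / Real.sqrt 2) +
              (ν / Real.sqrt (2 * Real.pi)) * Real.exp (-ν ^ 2 / 2))
          + (β + (1 / Real.sqrt Real.pi) * erfinv (2 * (1 - β) - 1) *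
              Real.exp (-(erfinv (2 * (1 - β) - 1)) ^ 2))
          + (((1 / 2) * erfc (ν / Real.sqrt 2) + β) * ν ^ 2 +
              ν * Real.sqrt (2 / Real.pi) *
                (Real.exp (-(erfinv (2 * (1 - β) - 1)) ^ 2) - Real.exp (-ν ^ 2 / 2)))}
      < α) :
    ∃ ε > (0 : ℝ), ∃ N : ℕ, ∀ n ≥ N,
      1 - ENNReal.ofReal (Real.exp (-ε * n)) ≤
        matrixGaussian (⌈α * n⌉₊) n
          {A | ∀ x : Fin n → ℝ, (∀ i, 0 ≤ x i) →
            (∃ K : Finset (Fin n), K.card ≤ ⌈β * n⌉₊ ∧ ∀ i ∉ K, x i = 0) →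
              UniqueL1MinNonneg A x} := by
  obtain ⟨v, ⟨ν, hν, rfl⟩, hv⟩ := exists_lt_of_csInf_lt (by exact ⟨_, 0, le_rfl, rfl⟩) hcond
  obtain ⟨t, ht, hb⟩ := expr_bound (ν := ν) hβ
  obtain ⟨s, hs0, hs1, hs⟩ := exists_s ht (hb.trans_lt hv)
  have fb := fun n => final_bound (α := α) hβ.1 ht hs0 hs1 n hν
  set Φ := α * cgf (fun x => -x ^ 2) (gaussianReal 0 1) s +
        cgf (gf ν t) (gaussianReal 0 1) s + s * (β * t) with hΦ
  refine ⟨-Φ / 2, by linarith, ⌈(Real.log 2 + s * t) / (-Φ / 2)⌉₊, fun n hn => ?_⟩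
  have hn' : (Real.log 2 + s * t) / (-Φ / 2) ≤ n := (Nat.le_ceil _).trans (by exact_mod_cast hn)
  rw [div_le_iff₀ (by linarith)] at hn'
  have hp : IsProbabilityMeasure (matrixGaussian (⌈α * n⌉₊) n) := by unfold matrixGaussian; infer_instance
  rw [tsub_le_iff_right]
  have hu := measure_union_le (μ := matrixGaussian (⌈α * n⌉₊) n) {A | ∀ x : Fin n → ℝ, (∀ i, 0 ≤ x i) →
            (∃ K : Finset (Fin n), K.card ≤ ⌈β * n⌉₊ ∧ ∀ i ∉ K, x i = 0) →
              UniqueL1MinNonneg A x} {A | ∀ x : Fin n → ℝ, (∀ i, 0 ≤ x i) →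
            (∃ K : Finset (Fin n), K.card ≤ ⌈β * n⌉₊ ∧ ∀ i ∉ K, x i = 0) →
              UniqueL1MinNonneg A x}ᶜ
  rw [Set.union_compl_self, measure_univ] at hu
  refine hu.trans (add_le_add le_rfl ((fb n).trans (ENNReal.ofReal_le_ofReal ?_)))
  have e2 : 2 * Real.exp (s * t + n * Φ) = Real.exp (Real.log 2 + (s * t + n * Φ)) := by
    rw [Real.exp_add (Real.log 2), Real.exp_log (by norm_num)]
  rw [e2]
  refine Real.exp_le_exp.2 ?_
  linarith
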